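/- For every integer n ≥ 3 there exist a Ważewski dendrite X of order n and a subgroup G of Homeo(X) such that G is dense in Homeo(X) and G is generated by the union of a subgroup K isomorphic to the symmetric group Sym(n) and a subgroup H generated by two elements; in particular, G is generated by n+1 elements and Homeo(X) contains a dense finitely generated subgroup. -/

import Mathlib

open Topology

/-- The set of connected components of a subset `S` of `X`. -/
def setComponents (X : Type*) [TopologicalSpace X] (S : Set X) : Set (Set X) :=
  {C | ∃ x ∈ S, C = connectedComponentIn S x}

/-- The order of a point `p` of `X`: the number of connected components of `X \ {p}`. -/
noncomputable def ptOrder (X : Type*) [TopologicalSpace X] (p : X) : ℕ :=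
  (setComponents X {p}ᶜ).ncard

/-- A dendrite: a nonempty, compact, connected, locally connected metrizable space
containing no subspace homeomorphic to the circle. -/
def IsDendrite (X : Type*) [TopologicalSpace X] : Prop :=
  Nonempty X ∧ CompactSpace X ∧ ConnectedSpace X ∧ LocallyConnectedSpace X ∧
    TopologicalSpace.MetrizableSpace X ∧
    ∀ S : Set X, IsEmpty (S ≃ₜ Circle)

/-- A Ważewski dendrite of order `n`: a dendrite all of whose points have order `1`, `2`
or `n`, and every arc (subspace homeomorphic to `[0,1]`) contains a point of order `n`. -/
def IsWazewskiDendrite (n : ℕ) (X : Type*) [TopologicalSpace X] : Prop :=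
  IsDendrite X ∧
  (∀ p : X, ptOrder X p = 1 ∨ ptOrder X p = 2 ∨ ptOrder X p = n) ∧
  ∀ A : Set X, Nonempty (A ≃ₜ unitInterval) → ∃ p ∈ A, ptOrder X p = n

/-- The group structure on self-homeomorphisms of `X`, with composition as product. -/
instance Homeomorph.instGroupSelf (X : Type*) [TopologicalSpace X] : Group (X ≃ₜ X) where
  mul f g := g.trans f
  one := Homeomorph.refl X
  inv := Homeomorph.symm
  mul_assoc _ _ _ := rfl
  one_mul _ := Homeomorph.ext fun _ => rfl
  mul_one _ := Homeomorph.ext fun _ => rfl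
  inv_mul_cancel := Homeomorph.self_trans_symm

/-- The compact-open topology on the group of self-homeomorphisms of `X` (for compact
metric `X`, this is the topology of uniform convergence). -/
instance Homeomorph.instTopSelf (X : Type*) [TopologicalSpace X] :
    TopologicalSpace (X ≃ₜ X) :=
  TopologicalSpace.induced (fun h : X ≃ₜ X => (h : C(X, X))) ContinuousMap.compactOpen


namespace Waz

open Topology Set Uniformity

/-- Sign attached to a letter. -/
noncomputable def sgn {N : ℕ} (i : Fin (N+3)) : ℝ := if i = 0 then -1 else if i = 1 then 1 else 0

/-- Prepend a letter to a sequence. -/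
def scons {N : ℕ} (i : Fin (N+3)) (s : ℕ → Fin (N+3)) : ℕ → Fin (N+3)
  | 0 => i
  | k+1 => s k

/-- Drop the first letter of a sequence. -/
def stail {N : ℕ} (s : ℕ → Fin (N+3)) : ℕ → Fin (N+3) := fun k => s (k+1)

theorem scons_stail {N : ℕ} (s : ℕ → Fin (N+3)) : scons (s 0) (stail s) = s := by
  funext k; cases k <;> rfl

theorem stail_scons {N : ℕ} (i : Fin (N+3)) (s : ℕ → Fin (N+3)) : stail (scons i s) = s := rfl

theorem continuous_stail {N : ℕ} : Continuous (stail (N := N)) :=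
  continuous_pi fun k => continuous_apply (k+1)

/-- Projection onto the main arc. -/
noncomputable def pz {N : ℕ} (s : ℕ → Fin (N+3)) : ℝ :=
  ∑' k : ℕ, (1/2 : ℝ)^(k+1) * ∏ i ∈ Finset.range k, sgn (s i)

theorem abs_sgn_le {N : ℕ} (i : Fin (N+3)) : |sgn i| ≤ 1 := by
  unfold sgn; split_ifs <;> simp

theorem term_le {N : ℕ} (s : ℕ → Fin (N+3)) (k : ℕ) :
    ‖(1/2 : ℝ)^(k+1) * ∏ i ∈ Finset.range k, sgn (s i)‖ ≤ (1/2 : ℝ)^(k+1) := by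
  rw [norm_mul, Real.norm_of_nonneg (by positivity), norm_prod]
  have : ∏ i ∈ Finset.range k, ‖sgn (s i)‖ ≤ 1 :=
    Finset.prod_le_one (fun _ _ => norm_nonneg _) (fun _ _ => abs_sgn_le _)
  have h2 : (0:ℝ) ≤ (1/2 : ℝ)^(k+1) := by positivity
  nlinarith

theorem summable_half : Summable (fun k : ℕ => (1/2 : ℝ)^(k+1)) :=
  (summable_nat_add_iff 1).2 summable_geometric_two

theorem tsum_half : ∑' k : ℕ, (1/2 : ℝ)^(k+1) = 1 := by
  have h := summable_geometric_two.tsum_eq_zero_add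
  rw [tsum_geometric_two] at h
  norm_num at h ⊢
  linarith

theorem summable_pz {N : ℕ} (s : ℕ → Fin (N+3)) :
    Summable (fun k : ℕ => (1/2 : ℝ)^(k+1) * ∏ i ∈ Finset.range k, sgn (s i)) :=
  Summable.of_norm_bounded summable_half (term_le s)

theorem continuous_pz {N : ℕ} : Continuous (pz (N := N)) := by
  unfold pz
  refine continuous_tsum (fun k => ?_) summable_half (fun k s => term_le s k)
  refine continuous_const.mul (continuous_finsetProd _ fun i _ => ?_)
  exact (continuous_of_discreteTopology (f := sgn (N := N))).comp (continuous_apply i)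

theorem pz_scons {N : ℕ} (i : Fin (N+3)) (s : ℕ → Fin (N+3)) :
    pz (scons i s) = 1/2 + sgn i / 2 * pz s := by
  unfold pz
  rw [(summable_pz (scons i s)).tsum_eq_zero_add, ← tsum_mul_left]
  congr 1
  · simp
  · congr 1; funext k
    rw [Finset.prod_range_succ']
    simp only [scons]
    ring

theorem pz_le {N : ℕ} (s : ℕ → Fin (N+3)) : pz s ≤ 1 := by
  rw [← tsum_half]
  exact (summable_pz s).tsum_le_tsum (fun k => (le_abs_self _).trans (term_le s k)) summable_half

theorem pz_nonneg {N : ℕ} (s : ℕ → Fin (N+3)) : 0 ≤ pz s := by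
  have h1 : -1 ≤ pz (stail s) := by
    have : pz (stail s) ≥ -∑' k : ℕ, (1/2 : ℝ)^(k+1) := by
      rw [← tsum_neg]
      exact summable_half.neg.tsum_le_tsum
        (fun k => (neg_le_of_abs_le (term_le _ k))) (summable_pz _)
    rw [tsum_half] at this; linarith
  have h2 := pz_le (stail s)
  have h3 := abs_le.1 (abs_sgn_le (s 0))
  rw [← scons_stail s, pz_scons]
  nlinarith [h3.1, h3.2]

/-- The sequence `111...`. -/
def e1s {N : ℕ} : ℕ → Fin (N+3) := fun _ => 1

/-- The sequence `0111...`. -/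
def es {N : ℕ} : ℕ → Fin (N+3) := scons 0 e1s

theorem scons_e1s {N : ℕ} : scons 1 (e1s (N := N)) = e1s := by
  funext k; cases k <;> rfl

theorem pz_e1s {N : ℕ} : pz (e1s (N := N)) = 1 := by
  have h := pz_scons (N := N) 1 e1s
  rw [scons_e1s] at h
  simp [sgn] at h
  linarith

theorem pz_es {N : ℕ} : pz (es (N := N)) = 0 := by
  rw [es, pz_scons, pz_e1s]; norm_num [sgn]

/-- The coordinates of the embedding. -/
noncomputable def pw {N : ℕ} : List (Fin (N+3)) → (ℕ → Fin (N+3)) → ℝ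
  | [], s => pz s
  | l :: v, s => if s 0 = l then pw v (stail s) else pw v es

theorem continuous_pw {N : ℕ} (v : List (Fin (N+3))) : Continuous (pw v) := by
  induction v with
  | nil => exact continuous_pz
  | cons l v ih =>
    have hc : IsClopen {s : ℕ → Fin (N+3) | s 0 = l} :=
      (isClopen_discrete ({l} : Set (Fin (N+3)))).preimage (continuous_apply 0)
    refine Continuous.if ?_ (ih.comp continuous_stail) continuous_const
    intro a ha
    rw [hc.frontier_eq] at ha
    exact ha.elim

/-- The embedding map from sequences. -/
noncomputable def PP {N : ℕ} (s : ℕ → Fin (N+3)) : List (Fin (N+3)) → ℝ := fun v => pw v s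

theorem continuous_PP {N : ℕ} : Continuous (PP (N := N)) := continuous_pi continuous_pw

/-- The map on the ambient space corresponding to prepending a letter. -/
noncomputable def phiA {N : ℕ} (i : Fin (N+3)) (f : List (Fin (N+3)) → ℝ) :
    List (Fin (N+3)) → ℝ
  | [] => 1/2 + sgn i / 2 * f []
  | l :: v => if i = l then f v else pw v es

theorem phiA_PP {N : ℕ} (i : Fin (N+3)) (s : ℕ → Fin (N+3)) : phiA i (PP s) = PP (scons i s) := by
  funext v
  cases v with
  | nil => simp only [phiA, PP, pw, pz_scons]
  | cons l v => rfl

theorem continuous_phiA {N : ℕ} (i : Fin (N+3)) : Continuous (phiA i) := by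
  refine continuous_pi fun v => ?_
  cases v with
  | nil => exact continuous_const.add (continuous_const.mul (continuous_apply _))
  | cons l v =>
    by_cases h : i = l
    · simp only [phiA, h, if_true]; exact continuous_apply v
    · simp only [phiA, h, if_false]; exact continuous_const

/-- The Wazewski dendrite. -/
def WX (N : ℕ) : Type := {f : List (Fin (N+3)) → ℝ // f ∈ Set.range (PP (N := N))}

noncomputable instance (N : ℕ) : UniformSpace (WX N) :=
  inferInstanceAs (UniformSpace {f : List (Fin (N+3)) → ℝ // f ∈ Set.range (PP (N := N))})

instance (N : ℕ) : TopologicalSpace.MetrizableSpace (WX N) :=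
  inferInstanceAs (TopologicalSpace.MetrizableSpace
    {f : List (Fin (N+3)) → ℝ // f ∈ Set.range (PP (N := N))})

instance (N : ℕ) : T2Space (WX N) :=
  inferInstanceAs (T2Space {f : List (Fin (N+3)) → ℝ // f ∈ Set.range (PP (N := N))})

instance (N : ℕ) : CompactSpace (WX N) :=
  isCompact_iff_compactSpace.1 (isCompact_range continuous_PP)

/-- The point of the dendrite coded by a sequence. -/
noncomputable def mk {N : ℕ} (s : ℕ → Fin (N+3)) : WX N := ⟨PP s, s, rfl⟩

theorem continuous_mk {N : ℕ} : Continuous (mk (N := N)) := continuous_PP.subtype_mk _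

theorem mk_surj {N : ℕ} (x : WX N) : ∃ s, mk s = x := by
  obtain ⟨f, s, rfl⟩ := x
  exact ⟨s, rfl⟩

/-- The contraction onto the cell of a letter. -/
noncomputable def phi {N : ℕ} (i : Fin (N+3)) (x : WX N) : WX N :=
  ⟨phiA i x.1, by obtain ⟨f, s, rfl⟩ := x; exact ⟨scons i s, (phiA_PP i s).symm⟩⟩

theorem phi_mk {N : ℕ} (i : Fin (N+3)) (s : ℕ → Fin (N+3)) : phi i (mk s) = mk (scons i s) :=
  Subtype.ext (phiA_PP i s)

theorem continuous_phi {N : ℕ} (i : Fin (N+3)) : Continuous (phi i) :=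
  ((continuous_phiA i).comp continuous_subtype_val).subtype_mk _

/-- The first endpoint. -/
noncomputable def ee {N : ℕ} : WX N := mk es
/-- The second endpoint. -/
noncomputable def e1 {N : ℕ} : WX N := mk e1s

/-- Coordinate functions. -/
def co {N : ℕ} (v : List (Fin (N+3))) (x : WX N) : ℝ := x.1 v

theorem continuous_co {N : ℕ} (v : List (Fin (N+3))) : Continuous (co v) :=
  (continuous_apply v).comp continuous_subtype_val

theorem co_ext {N : ℕ} {x y : WX N} (h : ∀ v, co v x = co v y) : x = y := Subtype.ext (funext h)

theorem co_nil {N : ℕ} (i : Fin (N+3)) (x : WX N) :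
    co [] (phi i x) = 1/2 + sgn i / 2 * co [] x := rfl

theorem co_cons {N : ℕ} (l : Fin (N+3)) (v) (i : Fin (N+3)) (x : WX N) :
    co (l :: v) (phi i x) = if i = l then co v x else co v ee := rfl

theorem co_nil_ee {N : ℕ} : co [] (ee (N := N)) = 0 := pz_es
theorem co_nil_e1 {N : ℕ} : co [] (e1 (N := N)) = 1 := pz_e1s

theorem co_nil_nonneg {N : ℕ} (x : WX N) : 0 ≤ co [] x := by
  obtain ⟨s, rfl⟩ := mk_surj x; exact pz_nonneg s
theorem co_nil_le {N : ℕ} (x : WX N) : co [] x ≤ 1 := by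
  obtain ⟨s, rfl⟩ := mk_surj x; exact pz_le s

theorem phi_inj {N : ℕ} (i : Fin (N+3)) : Function.Injective (phi i) := by
  intro x y h
  refine co_ext fun v => ?_
  have := congrArg (co (i :: v)) h
  simpa [co_cons] using this

theorem phi_surj {N : ℕ} (x : WX N) : ∃ i y, phi i y = x := by
  obtain ⟨s, rfl⟩ := mk_surj x
  exact ⟨s 0, mk (stail s), by rw [phi_mk, scons_stail]⟩

theorem phi_ne {N : ℕ} {i j : Fin (N+3)} {x y : WX N} (h : phi i x = phi j y) (hij : i ≠ j) :
    x = ee ∧ y = ee := by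
  constructor
  · refine co_ext fun v => ?_
    have := congrArg (co (i :: v)) h
    simpa [co_cons, hij.symm] using this
  · refine co_ext fun v => ?_
    have := congrArg (co (j :: v)) h
    simpa [co_cons, hij] using this.symm

theorem phi_ee {N : ℕ} (i j : Fin (N+3)) : phi i (ee (N := N)) = phi j ee := by
  refine co_ext fun v => ?_
  cases v with
  | nil => simp [co_nil, co_nil_ee]
  | cons l v => simp [co_cons]

theorem phi_zero_e1 {N : ℕ} : phi 0 (e1 (N := N)) = ee := by rw [e1, phi_mk]; rfl
theorem phi_one_e1 {N : ℕ} : phi 1 (e1 (N := N)) = e1 := by rw [e1, phi_mk, scons_e1s]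

theorem ee_ne_e1 {N : ℕ} : ee (N := N) ≠ e1 := by
  intro h
  have := congrArg (co []) h
  rw [co_nil_ee, co_nil_e1] at this
  norm_num at this

/-- Iterated contraction. -/
noncomputable def Phi {N : ℕ} : List (Fin (N+3)) → WX N → WX N
  | [], x => x
  | i :: w, x => phi i (Phi w x)

theorem continuous_Phi {N : ℕ} (w : List (Fin (N+3))) : Continuous (Phi w) := by
  induction w with
  | nil => exact continuous_id
  | cons i w ih => exact (continuous_phi i).comp ih

theorem Phi_inj {N : ℕ} (w : List (Fin (N+3))) : Function.Injective (Phi w) := by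
  induction w with
  | nil => exact Function.injective_id
  | cons i w ih => exact (phi_inj i).comp ih

theorem Phi_surj {N : ℕ} (m : ℕ) (x : WX N) : ∃ w, w.length = m ∧ ∃ y, Phi w y = x := by
  induction m generalizing x with
  | zero => exact ⟨[], rfl, x, rfl⟩
  | succ m ih =>
    obtain ⟨i, y, rfl⟩ := phi_surj x
    obtain ⟨w, hw, z, rfl⟩ := ih y
    exact ⟨i :: w, by simp [hw], z, rfl⟩

theorem Phi_mk {N : ℕ} (w : List (Fin (N+3))) (s) : ∃ t, Phi w (mk s) = mk t ∧
    ∀ k, (h : k < w.length) → t k = w[k] := by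
  induction w with
  | nil => exact ⟨s, rfl, by simp⟩
  | cons i w ih =>
    obtain ⟨t, ht, ht'⟩ := ih
    refine ⟨scons i t, by rw [Phi, ht, phi_mk], ?_⟩
    intro k hk
    cases k with
    | zero => rfl
    | succ k => exact ht' k (by simpa using hk)

theorem shrink {N : ℕ} {V : Set (WX N × WX N)} (hV : V ∈ 𝓤 (WX N)) :
    ∃ m : ℕ, ∀ w : List (Fin (N+3)), w.length = m → ∀ x y, (Phi w x, Phi w y) ∈ V := by
  have key : ∃ m : ℕ, {q : (ℕ → Fin (N+3)) × (ℕ → Fin (N+3)) | ∀ k < m, q.1 k = q.2 k} ⊆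
      (fun q => (mk q.1, mk q.2)) ⁻¹' V := by
    refine exists_subset_nhds_of_compactSpace
      (V := fun m : ℕ => {q : (ℕ → Fin (N+3)) × (ℕ → Fin (N+3)) | ∀ k < m, q.1 k = q.2 k})
      (U := (fun q => (mk q.1, mk q.2)) ⁻¹' V) ?_ ?_ ?_
    · intro a b
      exact ⟨max a b, fun q hq k hk => hq k (lt_of_lt_of_le hk (le_max_left _ _)),
        fun q hq k hk => hq k (lt_of_lt_of_le hk (le_max_right _ _))⟩
    · intro m
      simp only [Set.setOf_forall]
      refine isClosed_iInter fun k => isClosed_iInter fun _ => isClosed_eq ?_ ?_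
      · exact (continuous_apply k).comp continuous_fst
      · exact (continuous_apply k).comp continuous_snd
    · rintro ⟨s, t⟩ h
      have hst : s = t := by
        funext k
        exact (Set.mem_iInter.1 h (k+1)) k (Nat.lt_succ_self k)
      subst hst
      have hc : Continuous (fun q : (ℕ → Fin (N+3)) × (ℕ → Fin (N+3)) => (mk q.1, mk q.2)) :=
        (continuous_mk.comp continuous_fst).prodMk (continuous_mk.comp continuous_snd)
      exact hc.continuousAt.preimage_mem_nhds (nhds_le_uniformity _ hV)
  obtain ⟨m, hm⟩ := key
  refine ⟨m, fun w hw x y => ?_⟩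
  obtain ⟨s, rfl⟩ := mk_surj x
  obtain ⟨t, rfl⟩ := mk_surj y
  obtain ⟨s', hs, hs'⟩ := Phi_mk w s
  obtain ⟨t', ht, ht'⟩ := Phi_mk w t
  rw [hs, ht]
  refine @hm (s', t') fun k hk => ?_
  subst hw
  simp only [hs' k hk, ht' k hk]

end Waz

namespace Waz

open Topology Set Uniformity

/-- The homeomorphism group of the dendrite. -/
abbrev HX (N : ℕ) : Type := WX N ≃ₜ WX N

theorem hmul {N : ℕ} (f g : HX N) (x : WX N) : (f * g) x = f (g x) := rfl
theorem hone {N : ℕ} (x : WX N) : (1 : HX N) x = x := rfl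
theorem hinv_l {N : ℕ} (f : HX N) (x : WX N) : f⁻¹ (f x) = x := f.symm_apply_apply x
theorem hinv_r {N : ℕ} (f : HX N) (x : WX N) : f (f⁻¹ x) = x := f.apply_symm_apply x
theorem hinv_eq {N : ℕ} (f : HX N) {x y : WX N} (h : f x = y) : f⁻¹ y = x := by
  rw [← h, hinv_l]
theorem hext {N : ℕ} {f g : HX N} (h : ∀ i x, f (phi i x) = g (phi i x)) : f = g := by
  refine Homeomorph.ext fun x => ?_
  obtain ⟨i, y, rfl⟩ := phi_surj x
  exact h i y

theorem closedEmbedding_phi {N : ℕ} (i : Fin (N+3)) : IsClosedEmbedding (phi i) :=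
  (continuous_phi i).isClosedEmbedding (phi_inj i)

theorem closedEmbedding_Phi {N : ℕ} (w : List (Fin (N+3))) : IsClosedEmbedding (Phi w) :=
  (continuous_Phi w).isClosedEmbedding (Phi_inj w)

theorem exists_glue {N : ℕ} (f : Fin (N+3) → WX N → WX N) (hc : ∀ i, Continuous (f i))
    (h : ∀ i j, f i ee = f j ee) :
    ∃ g : WX N → WX N, Continuous g ∧ ∀ i x, g (phi i x) = f i x := by
  choose a b hab using phi_surj (N := N)
  have hg : ∀ i x, f (a (phi i x)) (b (phi i x)) = f i x := by
    intro i x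
    have h1 := hab (phi i x)
    by_cases hi : a (phi i x) = i
    · rw [hi] at h1
      rw [hi, phi_inj i h1]
    · obtain ⟨h2, h3⟩ := phi_ne h1 hi
      rw [h2, h3, h]
  refine ⟨fun x => f (a x) (b x), ?_, hg⟩
  rw [continuous_iff_isClosed]
  intro F hF
  have : (fun x => f (a x) (b x)) ⁻¹' F = ⋃ i, phi i '' (f i ⁻¹' F) := by
    ext x
    simp only [mem_preimage, mem_iUnion, mem_image]
    constructor
    · intro hx
      exact ⟨a x, b x, hx, hab x⟩
    · rintro ⟨i, y, hy, rfl⟩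
      rw [hg]; exact hy
  rw [this]
  exact isClosed_iUnion_of_finite fun i =>
    (closedEmbedding_phi i).isClosedMap _ (hF.preimage (hc i))

/-- Gluing of maps along the cells. -/
noncomputable def glue {N : ℕ} (f : Fin (N+3) → WX N → WX N) (hc : ∀ i, Continuous (f i))
    (h : ∀ i j, f i ee = f j ee) : WX N → WX N := (exists_glue f hc h).choose

theorem continuous_glue {N : ℕ} (f : Fin (N+3) → WX N → WX N) (hc) (h) :
    Continuous (glue f hc h) := (exists_glue f hc h).choose_spec.1

theorem glue_phi {N : ℕ} (f : Fin (N+3) → WX N → WX N) (hc) (h) (i) (x) :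
    glue f hc h (phi i x) = f i x := (exists_glue f hc h).choose_spec.2 i x

/-- Permutation of the cells. -/
noncomputable def sigF {N : ℕ} (π : Equiv.Perm (Fin (N+3))) : WX N → WX N :=
  glue (fun i => phi (π i)) (fun _ => continuous_phi _) (fun _ _ => phi_ee _ _)

theorem sigF_phi {N : ℕ} (π : Equiv.Perm (Fin (N+3))) (i) (x) :
    sigF π (phi i x) = phi (π i) x := glue_phi _ _ _ i x

/-- Permutation of the cells, as homomorphism. -/
noncomputable def sig {N : ℕ} : Equiv.Perm (Fin (N+3)) →* HX N where
  toFun π :=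
    { toFun := sigF π
      invFun := sigF π⁻¹
      left_inv := fun x => by
        obtain ⟨i, y, rfl⟩ := phi_surj x
        simp [sigF_phi]
      right_inv := fun x => by
        obtain ⟨i, y, rfl⟩ := phi_surj x
        simp [sigF_phi]
      continuous_toFun := continuous_glue _ _ _
      continuous_invFun := continuous_glue _ _ _ }
  map_one' := hext fun i x => sigF_phi _ i x
  map_mul' := fun a b => hext fun i x => by
    change sigF (a * b) (phi i x) = sigF a (sigF b (phi i x))
    simp [sigF_phi]

theorem sig_phi {N : ℕ} (π : Equiv.Perm (Fin (N+3))) (i) (x) :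
    sig π (phi i x) = phi (π i) x := sigF_phi π i x

theorem sig_injective {N : ℕ} : Function.Injective (sig (N := N)) := by
  intro a b h
  ext1 i
  by_contra hne
  have h1 : sig a (phi i e1) = sig b (phi i e1) := by rw [h]
  rw [sig_phi, sig_phi] at h1
  exact ee_ne_e1 (phi_ne h1 hne).1.symm

/-- Underlying function of a lift. -/
noncomputable def liftF {N : ℕ} (i : Fin (N+3)) (f : HX N) (hf : f ee = ee) : WX N → WX N :=
  glue (fun j x => if j = i then phi i (f x) else phi j x)
    (fun j => by
      by_cases h : j = i
      · simp only [h, if_true]; exact (continuous_phi i).comp f.continuous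
      · simp only [h, if_false]; exact continuous_phi j)
    (fun j k => by
      try dsimp only
      rw [hf]
      split_ifs <;> exact phi_ee _ _)

theorem liftF_same {N : ℕ} (i : Fin (N+3)) (f : HX N) (hf) (x) :
    liftF i f hf (phi i x) = phi i (f x) := by
  rw [liftF, glue_phi, if_pos rfl]
theorem liftF_ne {N : ℕ} (i : Fin (N+3)) (f : HX N) (hf) {j} (h : j ≠ i) (x) :
    liftF i f hf (phi j x) = phi j x := by
  rw [liftF, glue_phi, if_neg h]

theorem inv_fix {N : ℕ} {f : HX N} {x : WX N} (hf : f x = x) : f⁻¹ x = x := hinv_eq f hf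

/-- Lift of a homeomorphism to a cell. -/
noncomputable def liftH {N : ℕ} (i : Fin (N+3)) (f : HX N) (hf : f ee = ee) : HX N where
  toFun := liftF i f hf
  invFun := liftF i f⁻¹ (inv_fix hf)
  left_inv := fun x => by
    obtain ⟨j, y, rfl⟩ := phi_surj x
    by_cases h : j = i
    · subst h; rw [liftF_same, liftF_same, hinv_l]
    · rw [liftF_ne _ _ _ h, liftF_ne _ _ _ h]
  right_inv := fun x => by
    obtain ⟨j, y, rfl⟩ := phi_surj x
    by_cases h : j = i
    · subst h; rw [liftF_same, liftF_same, hinv_r]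
    · rw [liftF_ne _ _ _ h, liftF_ne _ _ _ h]
  continuous_toFun := continuous_glue _ _ _
  continuous_invFun := continuous_glue _ _ _

theorem lift_same {N : ℕ} (i : Fin (N+3)) (f : HX N) (hf) (x) :
    liftH i f hf (phi i x) = phi i (f x) := liftF_same i f hf x
theorem lift_ne {N : ℕ} (i : Fin (N+3)) (f : HX N) (hf) {j} (h : j ≠ i) (x) :
    liftH i f hf (phi j x) = phi j x := liftF_ne i f hf h x

/-- The transposition of the letters 0 and 1. -/
def sw {N : ℕ} : Equiv.Perm (Fin (N+3)) := Equiv.swap 0 1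

theorem sw_zero {N : ℕ} : sw (N := N) 0 = 1 := Equiv.swap_apply_left _ _
theorem sw_one {N : ℕ} : sw (N := N) 1 = 0 := Equiv.swap_apply_right _ _
theorem sw_sw {N : ℕ} (i) : sw (N := N) (sw i) = i := Equiv.swap_apply_self _ _ _
theorem sw_ne_zero {N : ℕ} {i} (h : i ≠ 1) : sw (N := N) i ≠ 0 := by
  intro h2; apply h; rw [← sw_sw i, h2, sw_zero]
theorem sw_ne_one {N : ℕ} {i} (h : i ≠ 0) : sw (N := N) i ≠ 1 := by
  intro h2; apply h; rw [← sw_sw i, h2, sw_one]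
theorem sw_of {N : ℕ} {i} (h : i ≠ 0) (h1 : i ≠ 1) : sw (N := N) i = i :=
  Equiv.swap_apply_of_ne_of_ne h h1

theorem sig_sw_ee {N : ℕ} : sig (N := N) sw ee = e1 := by
  rw [← phi_zero_e1, sig_phi, sw_zero, phi_one_e1]
theorem sig_sw_e1 {N : ℕ} : sig (N := N) sw e1 = ee := by
  conv_lhs => rw [← phi_one_e1]
  rw [sig_phi, sw_one, phi_zero_e1]
theorem sig_sw_sw {N : ℕ} (x) : sig (N := N) sw (sig sw x) = x := by
  obtain ⟨i, y, rfl⟩ := phi_surj x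
  rw [sig_phi, sig_phi, sw_sw]

/-- Auxiliary map for `tau`. -/
noncomputable def t1 {N : ℕ} : WX N → WX N :=
  glue (fun i x => if i = 0 then phi 1 (phi 0 (sig sw x)) else phi (sw i) x)
    (fun j => by
      by_cases h : j = 0
      · simp only [h, if_true]
        exact (continuous_phi _).comp ((continuous_phi _).comp (sig sw).continuous)
      · simp only [h, if_false]; exact continuous_phi _)
    (fun j k => by
      try dsimp only
      rw [sig_sw_ee, phi_zero_e1]
      split_ifs <;> exact phi_ee _ _)

theorem t1_zero {N : ℕ} (x : WX N) : t1 (phi 0 x) = phi 1 (phi 0 (sig sw x)) := by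
  rw [t1, glue_phi, if_pos rfl]
theorem t1_ne {N : ℕ} {i} (h : i ≠ 0) (x : WX N) : t1 (phi i x) = phi (sw i) x := by
  rw [t1, glue_phi, if_neg h]
theorem continuous_t1 {N : ℕ} : Continuous (t1 (N := N)) := continuous_glue _ _ _
theorem t1_ee {N : ℕ} : t1 (N := N) ee = phi 1 (phi 0 ee) := by
  rw [← phi_zero_e1, t1_zero, sig_sw_e1, phi_zero_e1]

/-- Underlying map of the involution `tau`. -/
noncomputable def tauF {N : ℕ} : WX N → WX N :=
  glue (fun i x => if i = 1 then t1 x else phi 1 (phi (sw i) x))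
    (fun j => by
      by_cases h : j = 1
      · simp only [h, if_true]; exact continuous_t1
      · simp only [h, if_false]; exact (continuous_phi _).comp (continuous_phi _))
    (fun j k => by
      have key : ∀ i : Fin (N+3), (if i = 1 then t1 ee else phi 1 (phi (sw i) ee)) =
          phi 1 (phi 0 (ee (N := N))) := by
        intro i
        split_ifs
        · exact t1_ee
        · rw [phi_ee (sw i) 0]
      try dsimp only
      rw [key, key])

theorem tauF_ne {N : ℕ} {i} (h : i ≠ 1) (x : WX N) :
    tauF (phi i x) = phi 1 (phi (sw i) x) := by rw [tauF, glue_phi, if_neg h]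
theorem tauF_one {N : ℕ} (x : WX N) : tauF (phi 1 x) = t1 x := by
  rw [tauF, glue_phi, if_pos rfl]

theorem tauF_tauF {N : ℕ} (x : WX N) : tauF (tauF x) = x := by
  obtain ⟨i, y, rfl⟩ := phi_surj x
  by_cases h : i = 1
  · subst h
    obtain ⟨j, z, rfl⟩ := phi_surj y
    rw [tauF_one]
    by_cases h : j = 0
    · subst h
      rw [t1_zero, tauF_one, t1_zero, sig_sw_sw]
    · rw [t1_ne h, tauF_ne (sw_ne_one h), sw_sw]
  · rw [tauF_ne h, tauF_one, t1_ne (sw_ne_zero h), sw_sw]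

/-- The involution `tau`. -/
noncomputable def tau {N : ℕ} : HX N where
  toFun := tauF
  invFun := tauF
  left_inv := tauF_tauF
  right_inv := tauF_tauF
  continuous_toFun := continuous_glue _ _ _
  continuous_invFun := continuous_glue _ _ _

/-- The translation along the main arc. -/
noncomputable def AA {N : ℕ} : HX N := tau * sig sw

theorem AA_ne {N : ℕ} {i} (h : i ≠ 0) (x : WX N) : AA (phi i x) = phi 1 (phi i x) := by
  rw [AA, hmul, sig_phi]
  exact (tauF_ne (sw_ne_one h) x).trans (by rw [sw_sw])
theorem AA_zero {N : ℕ} (x : WX N) : AA (phi 0 x) = t1 x := by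
  rw [AA, hmul, sig_phi, sw_zero]
  exact tauF_one x
theorem AA_00 {N : ℕ} (x : WX N) : AA (phi 0 (phi 0 x)) = phi 1 (phi 0 (sig sw x)) := by
  rw [AA_zero, t1_zero]
theorem AA_01 {N : ℕ} (x : WX N) : AA (phi 0 (phi 1 x)) = phi 0 x := by
  rw [AA_zero, t1_ne (by simp), sw_one]
theorem AA_0j {N : ℕ} {i} (h : i ≠ 0) (h1 : i ≠ 1) (x : WX N) :
    AA (phi 0 (phi i x)) = phi i x := by
  rw [AA_zero, t1_ne h, sw_of h h1]
theorem tau_10 {N : ℕ} (x : WX N) : tau (phi 1 (phi 0 x)) = phi 1 (phi 0 (sig sw x)) := by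
  refine (tauF_one _).trans ?_
  rw [t1_zero]

theorem AA_e1 {N : ℕ} : AA (N := N) e1 = e1 := by
  conv_lhs => rw [← phi_one_e1]
  rw [AA_ne (by simp), phi_one_e1, phi_one_e1]
theorem AA_ee {N : ℕ} : AA (N := N) ee = ee := by
  have : phi 0 (phi 1 e1) = ee (N := N) := by rw [phi_one_e1, phi_zero_e1]
  rw [← this, AA_01, phi_one_e1]

/-- The second generator. -/
noncomputable def bb {N : ℕ} : HX N := liftH 1 AA AA_ee

theorem pentagon {N : ℕ} : AA * AA * liftH 0 (AA (N := N)) AA_ee = bb * AA := by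
  have h10 : (1 : Fin (N+3)) ≠ 0 := by simp
  refine hext fun i x => ?_
  simp only [hmul, bb]
  by_cases h : i = 0
  · subst h
    rw [lift_same]
    obtain ⟨i, y, rfl⟩ := phi_surj x
    by_cases h : i = 0
    · subst h
      obtain ⟨i, z, rfl⟩ := phi_surj y
      rw [AA_00, lift_same, sig_phi]
      by_cases h : i = 0
      · subst h
        rw [AA_00, sw_zero, AA_01, AA_01, AA_00, sig_sw_sw]
      · by_cases h1 : i = 1
        · subst h1
          rw [AA_01, AA_00, sw_one, AA_00, AA_ne h10]
        · rw [AA_0j h h1, AA_0j h h1, AA_ne h, sw_of h h1, AA_0j h h1]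
    · rw [AA_ne h, AA_01, AA_zero, t1_ne h, lift_ne _ _ _ (sw_ne_one h)]
  · rw [lift_ne _ _ _ h, AA_ne h, AA_ne h10, lift_same, AA_ne h]

theorem lift_sig_one {N : ℕ} (π : Equiv.Perm (Fin (N+3))) (h0 : π 0 = 0) (hs) :
    liftH 1 (sig π) hs * AA = AA * sig π := by
  have h10 : (1 : Fin (N+3)) ≠ 0 := by simp
  refine hext fun i x => ?_
  simp only [hmul, sig_phi]
  by_cases h : i = 0
  · subst h
    rw [h0]
    obtain ⟨i, y, rfl⟩ := phi_surj x
    by_cases h : i = 0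
    · subst h
      rw [AA_00, lift_same, sig_phi, h0]
    · rw [AA_zero, t1_ne h, lift_ne _ _ _ (sw_ne_one h)]
  · have : π i ≠ 0 := fun h2 => h (π.injective (h2.trans h0.symm))
    rw [AA_ne h, AA_ne this, lift_same, sig_phi]

theorem lift_sig_zero {N : ℕ} (π : Equiv.Perm (Fin (N+3))) (h0 : π 0 = 0) (h1 : π 1 = 1) (hs) :
    AA * liftH 0 (sig π) hs = sig π * AA := by
  have h10 : (1 : Fin (N+3)) ≠ 0 := by simp
  refine hext fun i x => ?_
  simp only [hmul]
  by_cases h : i = 0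
  · subst h
    rw [lift_same]
    obtain ⟨i, y, rfl⟩ := phi_surj x
    rw [sig_phi]
    by_cases h : i = 0
    · subst h
      rw [h0, AA_00, sig_phi, h1]
    · by_cases h' : i = 1
      · subst h'
        rw [h1, AA_01, sig_phi, h0]
      · have a : π i ≠ 0 := fun h2 => h (π.injective (h2.trans h0.symm))
        have b : π i ≠ 1 := fun h2 => h' (π.injective (h2.trans h1.symm))
        rw [AA_0j h h', AA_0j a b, sig_phi]
  · rw [lift_ne _ _ _ h, AA_ne h, sig_phi, h1]

/-- The dense subgroup. -/
noncomputable def GG (N : ℕ) : Subgroup (HX N) :=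
  Subgroup.closure (Set.range (sig (N := N)) ∪ {tau, bb})

theorem sig_mem {N : ℕ} (π) : sig π ∈ GG N := Subgroup.subset_closure (Or.inl ⟨π, rfl⟩)
theorem tau_mem {N : ℕ} : tau ∈ GG N := Subgroup.subset_closure (Or.inr (by simp))
theorem bb_mem {N : ℕ} : bb ∈ GG N := Subgroup.subset_closure (Or.inr (by simp))
theorem AA_mem {N : ℕ} : AA ∈ GG N := mul_mem tau_mem (sig_mem _)

/-- `h` acts as `f` on the cell of `w` and trivially elsewhere. -/
def Act {N : ℕ} (w : List (Fin (N+3))) (f h : HX N) : Prop :=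
  (∀ x, h (Phi w x) = Phi w (f x)) ∧ ∀ y, y ∉ range (Phi w) → h y = y

theorem Act.mul {N : ℕ} {w : List (Fin (N+3))} {f h f' h' : HX N} (a : Act w f h)
    (a' : Act w f' h') : Act w (f * f') (h * h') :=
  ⟨fun x => by rw [hmul, a'.1, a.1, hmul], fun y hy => by rw [hmul, a'.2 y hy, a.2 y hy]⟩

theorem Act.inv {N : ℕ} {w : List (Fin (N+3))} {f h : HX N} (a : Act w f h) :
    Act w f⁻¹ h⁻¹ :=
  ⟨fun x => hinv_eq _ (by rw [a.1, hinv_r]), fun y hy => hinv_eq _ (a.2 y hy)⟩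

theorem Act.conj {N : ℕ} {w w' : List (Fin (N+3))} {f h : HX N} (a : Act w f h) (k : HX N)
    (hk : ∀ x, k (Phi w' x) = Phi w x) : Act w' f (k⁻¹ * h * k) := by
  refine ⟨fun x => ?_, fun y hy => ?_⟩
  · rw [hmul, hmul, hk, a.1]
    exact hinv_eq _ (hk _)
  · rw [hmul, hmul, a.2, hinv_l]
    rintro ⟨x, hx⟩
    rw [← hk] at hx
    exact hy ⟨x, k.injective hx⟩

theorem Phi_append {N : ℕ} (u v : List (Fin (N+3))) (x : WX N) :
    Phi (u ++ v) x = Phi u (Phi v x) := by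
  induction u with
  | nil => rfl
  | cons i u ih => simp only [List.cons_append, Phi, ih]

theorem Act.descend {N : ℕ} {u v : List (Fin (N+3))} {f g h : HX N} (a : Act (u ++ v) f h)
    (b : Act v f g) : Act u g h := by
  refine ⟨fun x => ?_, fun y hy => a.2 y ?_⟩
  · by_cases hx : x ∈ range (Phi v)
    · obtain ⟨z, rfl⟩ := hx
      rw [← Phi_append, a.1, Phi_append, b.1]
    · rw [b.2 x hx]
      apply a.2
      rintro ⟨z, hz⟩
      rw [Phi_append] at hz
      exact hx ⟨z, Phi_inj u hz⟩
  · rintro ⟨z, rfl⟩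
    exact hy ⟨Phi v z, (Phi_append u v z).symm⟩

theorem Act.ascend {N : ℕ} {u v : List (Fin (N+3))} {f g h : HX N} (a : Act u g h)
    (b : Act v f g) : Act (u ++ v) f h := by
  refine ⟨fun x => ?_, fun y hy => ?_⟩
  · rw [Phi_append, a.1, b.1, Phi_append]
  · by_cases hu : y ∈ range (Phi u)
    · obtain ⟨z, rfl⟩ := hu
      rw [a.1, b.2]
      rintro ⟨t, rfl⟩
      exact hy ⟨t, Phi_append u v t⟩
    · exact a.2 y hu

theorem act_lift {N : ℕ} (i : Fin (N+3)) (f : HX N) (hf) : Act [i] f (liftH i f hf) := by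
  refine ⟨fun x => lift_same i f hf x, fun y hy => ?_⟩
  obtain ⟨j, z, rfl⟩ := phi_surj y
  refine lift_ne i f hf ?_ z
  rintro rfl
  exact hy ⟨z, rfl⟩

/-- Elements fixing `ee` whose lift to the cell `1` is in `G`. -/
def L1 {N : ℕ} (f : HX N) : Prop := f ee = ee ∧ ∃ h ∈ GG N, Act [1] f h
/-- Elements fixing `ee` and `e1` whose lift to the cell `10` is in `G`. -/
def L2 {N : ℕ} (f : HX N) : Prop := f ee = ee ∧ f e1 = e1 ∧ ∃ h ∈ GG N, Act [1, 0] f h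

theorem L1.mul {N : ℕ} {f g : HX N} (hf : L1 f) (hg : L1 g) : L1 (f * g) := by
  obtain ⟨a, h, hh, ha⟩ := hf
  obtain ⟨a', h', hh', ha'⟩ := hg
  exact ⟨by rw [hmul, a', a], h * h', mul_mem hh hh', ha.mul ha'⟩
theorem L1.inv {N : ℕ} {f : HX N} (hf : L1 f) : L1 f⁻¹ := by
  obtain ⟨a, h, hh, ha⟩ := hf
  exact ⟨inv_fix a, h⁻¹, inv_mem hh, ha.inv⟩
theorem L2.mul {N : ℕ} {f g : HX N} (hf : L2 f) (hg : L2 g) : L2 (f * g) := by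
  obtain ⟨a, b, h, hh, ha⟩ := hf
  obtain ⟨a', b', h', hh', ha'⟩ := hg
  exact ⟨by rw [hmul, a', a], by rw [hmul, b', b], h * h', mul_mem hh hh', ha.mul ha'⟩
theorem L2.inv {N : ℕ} {f : HX N} (hf : L2 f) : L2 f⁻¹ := by
  obtain ⟨a, b, h, hh, ha⟩ := hf
  exact ⟨inv_fix a, inv_fix b, h⁻¹, inv_mem hh, ha.inv⟩

theorem lift_ee_ne {N : ℕ} {i : Fin (N+3)} (hi : i ≠ 0) (f : HX N) (hf) :
    liftH i f hf ee = ee := by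
  conv_lhs => rw [← phi_zero_e1]
  rw [lift_ne _ _ _ hi.symm, phi_zero_e1]
theorem lift_ee_zero {N : ℕ} (f : HX N) (hf) (h1 : f e1 = e1) :
    liftH 0 f hf ee = ee := by
  conv_lhs => rw [← phi_zero_e1]
  rw [lift_same, h1, phi_zero_e1]
theorem lift_e1_ne {N : ℕ} {i : Fin (N+3)} (hi : i ≠ 1) (f : HX N) (hf) :
    liftH i f hf e1 = e1 := by
  conv_lhs => rw [← phi_one_e1]
  rw [lift_ne _ _ _ hi.symm, phi_one_e1]
theorem lift_e1_one {N : ℕ} (f : HX N) (hf) (h1 : f e1 = e1) :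
    liftH 1 f hf e1 = e1 := by
  conv_lhs => rw [← phi_one_e1]
  rw [lift_same, h1, phi_one_e1]

/-- For a nonzero letter there is an element of `G` mapping the cell `1i` onto the cell `1`. -/
theorem exists_red {N : ℕ} {i : Fin (N+3)} (hi : i ≠ 0) :
    ∃ k ∈ GG N, ∀ x, k (phi 1 (phi i x)) = phi 1 x := by
  refine ⟨sig (Equiv.swap i 1) * AA⁻¹, mul_mem (sig_mem _) (inv_mem AA_mem), fun x => ?_⟩
  rw [hmul, hinv_eq AA (AA_ne hi x), sig_phi, Equiv.swap_apply_left]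

theorem L1.lift {N : ℕ} {f : HX N} (hf : L1 f) {i : Fin (N+3)} (hi : i ≠ 0) :
    L1 (liftH i f hf.1) := by
  refine ⟨lift_ee_ne hi _ _, ?_⟩
  obtain ⟨a, h, hh, ha⟩ := hf
  obtain ⟨k, hk, hk'⟩ := exists_red hi
  refine ⟨_, mul_mem (mul_mem (inv_mem hk) hh) hk, ?_⟩
  exact Act.descend (v := [i]) (u := [1]) (ha.conj k hk') (act_lift i f a)

theorem L2.lift_zero_L1 {N : ℕ} {f : HX N} (hf : L2 f) : L1 (liftH 0 f hf.1) := by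
  refine ⟨lift_ee_zero _ _ hf.2.1, ?_⟩
  obtain ⟨a, b, h, hh, ha⟩ := hf
  exact ⟨h, hh, Act.descend (v := [0]) (u := [1]) ha (act_lift 0 f a)⟩

theorem L1.lift_L2 {N : ℕ} {f : HX N} (hf : L1 f) {i : Fin (N+3)} (hi : i ≠ 0) (hi1 : i ≠ 1) :
    L2 (liftH i f hf.1) := by
  refine ⟨lift_ee_ne hi _ _, lift_e1_ne hi1 _ _, ?_⟩
  obtain ⟨a, h, hh, ha⟩ := hf
  obtain ⟨k, hk, hk'⟩ := exists_red hi
  have hk2 : ∀ x, (k * bb : HX N) (phi 1 (phi 0 (phi i x))) = phi 1 x := by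
    intro x
    rw [hmul, bb, lift_same, AA_0j hi hi1, hk']
  have hm : (k * bb : HX N) ∈ GG N := mul_mem hk bb_mem
  refine ⟨_, mul_mem (mul_mem (inv_mem hm) hh) hm, ?_⟩
  exact Act.descend (v := [i]) (u := [1, 0]) (ha.conj (k * bb) hk2) (act_lift i f a)

theorem L2.lift_one {N : ℕ} {f : HX N} (hf : L2 f) : L2 (liftH 1 f hf.1) := by
  refine ⟨lift_ee_ne (by simp) _ _, lift_e1_one _ _ hf.2.1, ?_⟩
  obtain ⟨a, b, h, hh, ha⟩ := hf
  have hk2 : ∀ x : WX N, bb (phi 1 (phi 0 (phi 1 x))) = phi 1 (phi 0 x) := by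
    intro x
    rw [bb, lift_same, AA_01]
  refine ⟨_, mul_mem (mul_mem (inv_mem bb_mem) hh) bb_mem, ?_⟩
  exact Act.descend (v := [1]) (u := [1, 0]) (ha.conj bb hk2) (act_lift 1 f a)

theorem L2.lift_zero {N : ℕ} {f : HX N} (hf : L2 f) : L2 (liftH 0 f hf.1) := by
  refine ⟨lift_ee_zero _ _ hf.2.1, lift_e1_ne (by simp) _ _, ?_⟩
  obtain ⟨a, b, h, hh, ha⟩ := hf
  have hk2 : ∀ x : WX N, (bb * tau : HX N) (phi 1 (phi 0 (phi 0 x))) = phi 1 (phi 0 x) := by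
    intro x
    rw [hmul, tau_10, sig_phi, sw_zero, bb, lift_same, AA_01]
  have hm : (bb * tau : HX N) ∈ GG N := mul_mem bb_mem tau_mem
  refine ⟨_, mul_mem (mul_mem (inv_mem hm) hh) hm, ?_⟩
  exact Act.descend (v := [0]) (u := [1, 0]) (ha.conj (bb * tau) hk2) (act_lift 0 f a)

theorem L1_AA {N : ℕ} : L1 (AA (N := N)) := ⟨AA_ee, bb, bb_mem, act_lift 1 _ _⟩

theorem L2_of_L1 {N : ℕ} {f : HX N} (a : f ee = ee) (b : f e1 = e1) (h : L1 (liftH 0 f a)) :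
    L2 f := by
  obtain ⟨_, h, hh, hh'⟩ := h
  exact ⟨a, b, h, hh, hh'.ascend (act_lift 0 f a)⟩

theorem L2_AA {N : ℕ} : L2 (AA (N := N)) := by
  refine L2_of_L1 AA_ee AA_e1 ?_
  have h : liftH 0 (AA (N := N)) AA_ee = (AA * AA)⁻¹ * (bb * AA) := by
    rw [← pentagon]; group
  rw [h]
  exact (L1_AA.mul L1_AA).inv.mul ((L1_AA.lift (i := 1) (by simp)).mul L1_AA)

theorem sig_ee {N : ℕ} {π : Equiv.Perm (Fin (N+3))} (h0 : π 0 = 0) : sig π ee = ee := by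
  rw [← phi_zero_e1, sig_phi, h0]
theorem sig_e1 {N : ℕ} {π : Equiv.Perm (Fin (N+3))} (h0 : π 1 = 1) : sig π e1 = e1 := by
  conv_lhs => rw [← phi_one_e1]
  rw [sig_phi, h0, phi_one_e1]

theorem L1_sig {N : ℕ} {π : Equiv.Perm (Fin (N+3))} (h0 : π 0 = 0) : L1 (sig π) := by
  refine ⟨sig_ee h0, liftH 1 (sig π) (sig_ee h0), ?_, act_lift 1 _ _⟩
  have h : liftH 1 (sig π) (sig_ee h0) = AA * sig π * AA⁻¹ := by
    rw [← lift_sig_one π h0 (sig_ee h0)]; group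
  rw [h]
  exact mul_mem (mul_mem AA_mem (sig_mem _)) (inv_mem AA_mem)

theorem L2_sig {N : ℕ} {π : Equiv.Perm (Fin (N+3))} (h0 : π 0 = 0) (h1 : π 1 = 1) :
    L2 (sig π) := by
  refine L2_of_L1 (sig_ee h0) (sig_e1 h1) ?_
  have h : liftH 0 (sig π) (sig_ee h0) = AA⁻¹ * (sig π * AA) := by
    rw [← lift_sig_zero π h0 h1 (sig_ee h0)]; group
  rw [h]
  exact L1_AA.inv.mul ((L1_sig h0).mul L1_AA)

end Waz

namespace Waz

open Topology Set Uniformity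

/-- The central branch point. -/
noncomputable def qq {N : ℕ} : WX N := phi 0 ee

theorem phi_ee_q {N : ℕ} (i : Fin (N+3)) : phi i ee = qq (N := N) := phi_ee i 0

theorem phi_eq_q {N : ℕ} {i : Fin (N+3)} {x : WX N} : phi i x = qq ↔ x = ee := by
  constructor
  · intro h
    rw [← phi_ee_q i] at h
    exact phi_inj i h
  · rintro rfl
    exact phi_ee_q i

theorem phi_eq_ee {N : ℕ} {i : Fin (N+3)} {x : WX N} : phi i x = ee ↔ i = 0 ∧ x = e1 := by
  constructor
  · intro h
    rw [← phi_zero_e1] at h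
    by_cases hi : i = 0
    · subst hi
      exact ⟨rfl, phi_inj _ h⟩
    · exact absurd (phi_ne h hi).2.symm ee_ne_e1
  · rintro ⟨rfl, rfl⟩
    exact phi_zero_e1

theorem phi_eq_e1 {N : ℕ} {i : Fin (N+3)} {x : WX N} : phi i x = e1 ↔ i = 1 ∧ x = e1 := by
  constructor
  · intro h
    rw [← phi_one_e1] at h
    by_cases hi : i = 1
    · subst hi
      exact ⟨rfl, phi_inj _ h⟩
    · exact absurd (phi_ne h hi).2.symm ee_ne_e1
  · rintro ⟨rfl, rfl⟩
    exact phi_one_e1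

theorem qq_ne_ee {N : ℕ} : qq (N := N) ≠ ee := fun h => ee_ne_e1 (phi_eq_ee.1 h).2
theorem qq_ne_e1 {N : ℕ} : qq (N := N) ≠ e1 := fun h => ee_ne_e1 (phi_eq_e1.1 h).2

/-- The branch points. -/
def Br {N : ℕ} : Set (WX N) := {x | ∃ u, x = Phi u qq}

theorem qq_mem_Br {N : ℕ} : qq (N := N) ∈ Br := ⟨[], rfl⟩
theorem phi_mem_Br {N : ℕ} {i : Fin (N+3)} {x : WX N} (h : x ∈ Br) : phi i x ∈ Br := by
  obtain ⟨u, rfl⟩ := h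
  exact ⟨i :: u, rfl⟩

theorem Phi_q_ne {N : ℕ} (u : List (Fin (N+3))) : Phi u qq ≠ ee ∧ Phi u qq ≠ e1 := by
  induction u with
  | nil => exact ⟨qq_ne_ee, qq_ne_e1⟩
  | cons i u ih =>
    exact ⟨fun h => ih.2 (phi_eq_ee.1 h).2, fun h => ih.2 (phi_eq_e1.1 h).2⟩

theorem ee_not_Br {N : ℕ} : ee (N := N) ∉ Br := fun ⟨u, hu⟩ => (Phi_q_ne u).1 hu.symm
theorem e1_not_Br {N : ℕ} : e1 (N := N) ∉ Br := fun ⟨u, hu⟩ => (Phi_q_ne u).2 hu.symm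

theorem const_of_cells {N : ℕ} (m : ℕ) : ∀ f : WX N → Bool,
    (∀ w : List (Fin (N+3)), w.length = m → ∀ x y, f (Phi w x) = f (Phi w y)) →
    ∀ x y, f x = f y := by
  induction m with
  | zero => intro f h x y; exact h [] rfl x y
  | succ m ih =>
    intro f h x y
    have key : ∀ x, f x = f qq := by
      intro x
      obtain ⟨i, y, rfl⟩ := phi_surj x
      rw [← phi_ee_q i]
      exact ih (fun z => f (phi i z)) (fun w hw x y => h (i :: w) (by simp [hw]) x y) y ee
    rw [key x, key y]

instance {N : ℕ} : PreconnectedSpace (WX N) := by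
  refine preconnectedSpace_of_forall_constant fun f hf => ?_
  have hV : {p : WX N × WX N | f p.1 = f p.2} ∈ 𝓤 (WX N) := by
    rw [← nhdsSet_diagonal_eq_uniformity]
    refine IsOpen.mem_nhdsSet (?_) |>.2 ?_
    · exact (isOpen_discrete {p : Bool × Bool | p.1 = p.2}).preimage
        ((hf.comp continuous_fst).prodMk (hf.comp continuous_snd))
    · rintro ⟨x, y⟩ h
      have : x = y := h
      simp [this]
  obtain ⟨m, hm⟩ := shrink hV
  intro x y
  exact const_of_cells m f (fun w hw x y => hm w hw x y) x y

instance {N : ℕ} : ConnectedSpace (WX N) where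
  toNonempty := ⟨ee⟩

theorem conn_cell {N : ℕ} (w : List (Fin (N+3))) : IsPreconnected (range (Phi w)) :=
  isPreconnected_range (continuous_Phi w)

theorem conn_phi {N : ℕ} (i : Fin (N+3)) : IsPreconnected (range (phi i)) :=
  isPreconnected_range (continuous_phi i)

theorem closed_phi {N : ℕ} (i : Fin (N+3)) : IsClosed (range (phi i)) :=
  (closedEmbedding_phi i).isClosed_range
theorem closed_cell {N : ℕ} (w : List (Fin (N+3))) : IsClosed (range (Phi w)) :=
  (closedEmbedding_Phi w).isClosed_range

/-- Union of all cells other than the `i`-th. -/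
def CC {N : ℕ} (i : Fin (N+3)) : Set (WX N) := ⋃ j : {j : Fin (N+3) // j ≠ i}, range (phi j.1)

theorem mem_CC {N : ℕ} {i : Fin (N+3)} {x : WX N} : x ∈ CC i ↔ ∃ j, j ≠ i ∧ ∃ y, phi j y = x := by
  simp [CC]

theorem exists_ne_letter {N : ℕ} (i : Fin (N+3)) : ∃ j, j ≠ i := exists_ne i

theorem qq_mem_CC {N : ℕ} (i : Fin (N+3)) : qq ∈ CC i := by
  obtain ⟨j, hj⟩ := exists_ne_letter i
  exact mem_CC.2 ⟨j, hj, ee, phi_ee_q j⟩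

theorem closed_CC {N : ℕ} (i : Fin (N+3)) : IsClosed (CC i) :=
  isClosed_iUnion_of_finite fun j => closed_phi j.1

theorem conn_CC {N : ℕ} (i : Fin (N+3)) : IsPreconnected (CC i) := by
  refine isPreconnected_of_forall qq fun y hy => ?_
  obtain ⟨j, hj, z, rfl⟩ := mem_CC.1 hy
  exact ⟨range (phi j), fun x ⟨t, ht⟩ => mem_CC.2 ⟨j, hj, t, ht⟩, ⟨ee, phi_ee_q j⟩, ⟨z, rfl⟩,
    conn_phi j⟩

theorem CC_union {N : ℕ} (i : Fin (N+3)) (x : WX N) : x ∈ range (phi i) ∨ x ∈ CC i := by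
  obtain ⟨j, y, rfl⟩ := phi_surj x
  by_cases h : j = i
  · subst h; exact Or.inl ⟨y, rfl⟩
  · exact Or.inr (mem_CC.2 ⟨j, h, y, rfl⟩)

theorem CC_inter {N : ℕ} {i : Fin (N+3)} {x : WX N} (h : phi i x ∈ CC i) : x = ee := by
  obtain ⟨j, hj, y, hy⟩ := mem_CC.1 h
  exact (phi_ne hy hj).2

theorem small_cells {N : ℕ} {x : WX N} {U : Set (WX N)} (hU : U ∈ 𝓝 x) :
    ∃ m, ∀ w : List (Fin (N+3)), w.length = m → x ∈ range (Phi w) → range (Phi w) ⊆ U := by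
  obtain ⟨V, hV, hVU⟩ := UniformSpace.mem_nhds_iff.1 hU
  obtain ⟨m, hm⟩ := shrink hV
  refine ⟨m, ?_⟩
  rintro w hw ⟨y, rfl⟩ z ⟨t, rfl⟩
  exact hVU (hm w hw y t)

theorem same_cells {N : ℕ} {x y : WX N}
    (h : ∀ m, ∃ w : List (Fin (N+3)), w.length = m ∧ x ∈ range (Phi w) ∧ y ∈ range (Phi w)) :
    x = y := by
  by_contra hne
  obtain ⟨m, hm⟩ := small_cells (x := x) (isOpen_compl_singleton.mem_nhds (show x ∈ {y}ᶜ from hne))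
  obtain ⟨w, hw, hx, hy⟩ := h m
  exact hm w hw hx hy rfl

theorem conn_compl_e1 {N : ℕ} : IsPreconnected ({e1}ᶜ : Set (WX N)) := by
  have key : ∀ m : ℕ, ∃ T : Set (WX N), IsPreconnected T ∧ ee ∈ T ∧ e1 ∉ T ∧
      ∀ y, y ∉ T → y ∈ range (Phi (List.replicate m 1)) := by
    have h1 : ee ∈ CC (1 : Fin (N+3)) := mem_CC.2 ⟨0, by simp, e1, phi_zero_e1⟩
    have h2 : e1 ∉ CC (1 : Fin (N+3)) := fun h => by
      rw [← phi_one_e1] at h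
      exact ee_ne_e1 (CC_inter h).symm
    intro m
    induction m with
    | zero =>
      refine ⟨CC 1, conn_CC 1, h1, h2, fun y _ => ⟨y, rfl⟩⟩
    | succ m ih =>
      obtain ⟨T, hT, he, he1, hT2⟩ := ih
      refine ⟨CC 1 ∪ phi 1 '' T, ?_, Or.inl h1, ?_, ?_⟩
      · exact IsPreconnected.union qq (qq_mem_CC 1) ⟨ee, he, phi_ee_q 1⟩ (conn_CC 1)
          (hT.image _ (continuous_phi 1).continuousOn)
      · rintro (h | ⟨y, hy, h⟩)
        · exact h2 h
        · rw [(phi_eq_e1.1 h).2] at hy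
          exact he1 hy
      · intro y hy
        rcases CC_union 1 y with ⟨z, rfl⟩ | h
        · obtain ⟨t, ht⟩ := hT2 z fun hz => hy (Or.inr ⟨z, hz, rfl⟩)
          exact ⟨t, by rw [← ht]; rfl⟩
        · exact absurd (Or.inl h) hy
  refine isPreconnected_of_forall ee fun y hy => ?_
  by_contra hcon
  refine hy (same_cells fun m => ?_)
  obtain ⟨T, hT, he, he1, hT2⟩ := key m
  refine ⟨List.replicate m 1, by simp, ?_, ?_⟩
  · by_contra hy2
    refine hcon ⟨T, fun z hz => ?_, he, ?_, hT⟩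
    · rintro rfl; exact he1 hz
    · by_contra hyT; exact hy2 (hT2 y hyT)
  · exact hT2 _ he1

theorem conn_compl_ee {N : ℕ} : IsPreconnected ({ee}ᶜ : Set (WX N)) := by
  have := conn_compl_e1.image _ (sig (N := N) sw).continuous.continuousOn
  rwa [image_compl_eq (sig (N := N) sw).bijective, image_singleton, sig_sw_e1] at this

theorem conn_branch {N : ℕ} (i : Fin (N+3)) : IsPreconnected (phi i '' {ee}ᶜ) :=
  conn_compl_ee.image _ (continuous_phi i).continuousOn

theorem avoid_q {N : ℕ} {A : Set (WX N)} (hA : IsPreconnected A) (hq : qq ∉ A) :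
    ∃ i, A ⊆ range (phi i) := by
  rcases A.eq_empty_or_nonempty with rfl | ⟨x, hx⟩
  · exact ⟨0, empty_subset _⟩
  obtain ⟨i, y, rfl⟩ := phi_surj x
  refine ⟨i, ?_⟩
  rcases isPreconnected_iff_subset_of_disjoint_closed.1 hA _ _ (closed_phi i) (closed_CC i)
    (fun z _ => CC_union i z) (by
      ext z
      simp only [mem_inter_iff, mem_empty_iff_false, iff_false, not_and]
      rintro hz ⟨t, rfl⟩ h
      rw [CC_inter h, phi_ee_q] at hz
      exact hq hz) with h | h
  · exact h
  · have := CC_inter (h hx)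
    subst this
    rw [phi_ee_q] at hx
    exact absurd hx hq

theorem avoid_Br {N : ℕ} {A : Set (WX N)} (hA : IsPreconnected A) (hq : Disjoint A Br) :
    A.Subsingleton := by
  have key : ∀ m, ∀ A : Set (WX N), IsPreconnected A → Disjoint A Br →
      ∃ w : List (Fin (N+3)), w.length = m ∧ A ⊆ range (Phi w) := by
    intro m
    induction m with
    | zero => exact fun A _ _ => ⟨[], rfl, fun x _ => ⟨x, rfl⟩⟩
    | succ m ih =>
      intro A hA hd
      obtain ⟨i, hi⟩ := avoid_q hA fun h => disjoint_left.1 hd h qq_mem_Br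
      have hp : phi i '' (phi i ⁻¹' A) = A := image_preimage_eq_of_subset hi
      obtain ⟨w, hw, hw2⟩ := ih (phi i ⁻¹' A)
        ((closedEmbedding_phi i).isInducing.isPreconnected_image.1 (by rwa [hp]))
        (disjoint_left.2 fun x hx hb => disjoint_left.1 hd hx (phi_mem_Br hb))
      refine ⟨i :: w, by simp [hw], ?_⟩
      rw [← hp]
      rintro _ ⟨x, hx, rfl⟩
      obtain ⟨t, rfl⟩ := hw2 hx
      exact ⟨t, rfl⟩
  intro x hx y hy
  refine same_cells fun m => ?_
  obtain ⟨w, hw, h⟩ := key m A hA hq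
  exact ⟨w, hw, h hx, h hy⟩

/-- The star of a point. -/
def star {N : ℕ} (x : WX N) (m : ℕ) : Set (WX N) :=
  {y | ∃ w : List (Fin (N+3)), w.length = m ∧ x ∈ range (Phi w) ∧ y ∈ range (Phi w)}

theorem star_nhds {N : ℕ} (x : WX N) (m : ℕ) : star x m ∈ 𝓝 x := by
  have hf : {w : List (Fin (N+3)) | w.length = m ∧ x ∉ range (Phi w)}.Finite :=
    (List.finite_length_eq _ m).subset fun w hw => hw.1
  have hc : IsClosed (⋃ w ∈ {w : List (Fin (N+3)) | w.length = m ∧ x ∉ range (Phi w)},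
      range (Phi w)) := hf.isClosed_biUnion fun w _ => closed_cell w
  refine Filter.mem_of_superset (hc.isOpen_compl.mem_nhds (x := x) ?_) ?_
  · simp only [mem_compl_iff, mem_iUnion, not_exists]
    rintro w hw h
    exact hw.2 h
  · intro y hy
    obtain ⟨w, hw, t, ht⟩ := Phi_surj m y
    refine ⟨w, hw, ?_, ⟨t, ht⟩⟩
    by_contra hx
    exact hy (mem_biUnion (x := w) ⟨hw, hx⟩ ⟨t, ht⟩)

instance {N : ℕ} : LocallyConnectedSpace (WX N) := by
  refine locallyConnectedSpace_of_connected_bases (fun x m => star x m) (fun _ _ => True)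
    (fun x => ⟨fun t => ⟨fun ht => ?_, ?_⟩⟩) ?_
  · obtain ⟨m, hm⟩ := small_cells ht
    refine ⟨m, trivial, ?_⟩
    rintro y ⟨w, hw, hx, hy⟩
    exact hm w hw hx hy
  · rintro ⟨m, -, hm⟩
    exact Filter.mem_of_superset (star_nhds x m) hm
  · intro x m _
    refine isPreconnected_of_forall x ?_
    rintro y ⟨w, hw, hx, hy⟩
    exact ⟨range (Phi w), fun z hz => ⟨w, hw, hx, hz⟩, hx, hy, conn_cell w⟩

theorem co_ends {N : ℕ} (v : List (Fin (N+3))) :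
    (co v ee = 0 ∨ co v ee = 1) ∧ (co v e1 = 0 ∨ co v e1 = 1) := by
  induction v with
  | nil => exact ⟨Or.inl co_nil_ee, Or.inr co_nil_e1⟩
  | cons l v ih =>
    constructor
    · rw [← phi_zero_e1, co_cons]
      split_ifs
      exacts [ih.2, ih.1]
    · rw [← phi_one_e1, co_cons]
      split_ifs
      exacts [ih.2, ih.1]

theorem irr_letter {N : ℕ} {r : ℝ} (hr : Irrational r) {i : Fin (N+3)} {x : WX N}
    (h : co [] (phi i x) = r) :
    (i = 0 ∧ r < 1/2 ∧ co [] x = 1 - 2 * r) ∨ (i = 1 ∧ 1/2 < r ∧ co [] x = 2 * r - 1) := by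
  rw [co_nil, sgn] at h
  have h0 := co_nil_nonneg x
  have hne : r ≠ 1/2 := by
    intro h
    apply hr
    exact ⟨1/2, by rw [h]; norm_num⟩
  split_ifs at h with h1 h2
  · left
    refine ⟨h1, ?_, by linarith⟩
    exact lt_of_le_of_ne (by linarith) hne
  · right
    refine ⟨h2, ?_, by linarith⟩
    exact lt_of_le_of_ne (by linarith) hne.symm
  · exact absurd (by linarith) hne

theorem irr_cells {N : ℕ} (m : ℕ) : ∀ {r : ℝ}, Irrational r → ∀ {x y : WX N}, co [] x = r →
    co [] y = r →
    ∃ w : List (Fin (N+3)), w.length = m ∧ x ∈ range (Phi w) ∧ y ∈ range (Phi w) := by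
  induction m with
  | zero => exact fun _ _ _ _ _ => ⟨[], rfl, ⟨_, rfl⟩, ⟨_, rfl⟩⟩
  | succ m ih =>
    intro r hr x y hx hy
    obtain ⟨i, x, rfl⟩ := phi_surj x
    obtain ⟨j, y, rfl⟩ := phi_surj y
    have h1 : Irrational (1 - 2 * r) := by
      have := (hr.ratCast_mul (q := 2) (by norm_num)).ratCast_sub 1
      simpa using this
    have h2 : Irrational (2 * r - 1) := by
      have := (hr.ratCast_mul (q := 2) (by norm_num)).sub_ratCast 1
      simpa using this
    rcases irr_letter hr hx with ⟨rfl, a, b⟩ | ⟨rfl, a, b⟩ <;>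
    rcases irr_letter hr hy with ⟨rfl, a', b'⟩ | ⟨rfl, a', b'⟩
    · obtain ⟨w, hw, ⟨s, rfl⟩, ⟨t, rfl⟩⟩ := ih h1 b b'
      exact ⟨0 :: w, by simp [hw], ⟨s, rfl⟩, ⟨t, rfl⟩⟩
    · linarith
    · linarith
    · obtain ⟨w, hw, ⟨s, rfl⟩, ⟨t, rfl⟩⟩ := ih h2 b b'
      exact ⟨1 :: w, by simp [hw], ⟨s, rfl⟩, ⟨t, rfl⟩⟩

theorem irr_fiber {N : ℕ} (v : List (Fin (N+3))) {r : ℝ} (hr : Irrational r) :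
    ∀ {x y : WX N}, co v x = r → co v y = r → x = y := by
  induction v with
  | nil => exact fun hx hy => same_cells fun m => irr_cells m hr hx hy
  | cons l v ih =>
    have hne : co v (ee (N := N)) ≠ r := by
      rintro h
      rcases (co_ends (N := N) v).1 with h1 | h1 <;> rw [h1] at h
      · exact hr ⟨0, by simpa using h⟩
      · exact hr ⟨1, by simpa using h⟩
    intro x y hx hy
    obtain ⟨i, x, rfl⟩ := phi_surj x
    obtain ⟨j, y, rfl⟩ := phi_surj y
    rw [co_cons] at hx hy
    split_ifs at hx hy with h1 h2
    · rw [h1, h2, ih hx hy]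
    all_goals exact absurd (by assumption) hne

theorem circle_compl (c : Circle) : IsPreconnected ({c}ᶜ : Set Circle) :=
  (Circle.isPathConnected_compl_singleton c).isConnected.isPreconnected

theorem no_circle {N : ℕ} (S : Set (WX N)) : IsEmpty (S ≃ₜ Circle) := by
  refine ⟨fun h => ?_⟩
  let g : Circle → WX N := fun c => (h.symm c : WX N)
  have hg : Continuous g := continuous_subtype_val.comp h.symm.continuous
  have gi : Function.Injective g := Subtype.val_injective.comp h.symm.injective
  obtain ⟨a, b, hab⟩ : ∃ a b : Circle, a ≠ b := ⟨_, _, Circle.exp_pi_ne_one⟩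
  have : ∃ v, co v (g a) ≠ co v (g b) := by
    by_contra hc
    push Not at hc
    exact hab (gi (co_ext hc))
  obtain ⟨v, hv⟩ := this
  have hco : Continuous fun c => co v (g c) := (continuous_co v).comp hg
  wlog hlt : co v (g a) < co v (g b) generalizing a b
  · exact this b a hab.symm hv.symm (lt_of_le_of_ne (not_lt.1 hlt) hv.symm)
  obtain ⟨r, hr, h1, h2⟩ := exists_irrational_btwn hlt
  obtain ⟨c, -, hc⟩ := (isPreconnected_univ (α := Circle)).intermediate_value (mem_univ a)
    (mem_univ b) hco.continuousOn ⟨h1.le, h2.le⟩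
  dsimp only at hc
  obtain ⟨d, hd, hd2⟩ := (circle_compl c).intermediate_value (a := a) (b := b)
    (by rintro rfl; exact absurd hc h1.ne) (by rintro rfl; exact absurd hc h2.ne')
    hco.continuousOn ⟨h1.le, h2.le⟩
  exact hd (gi (irr_fiber v hr hd2 hc))

end Waz

namespace Waz

open Topology Set Uniformity

theorem AA_0q {N : ℕ} : AA (phi 0 qq) = qq (N := N) := by
  rw [← phi_ee_q 1, AA_01, phi_ee_q]; exact (phi_ee_q 1).symm
theorem AA_q {N : ℕ} : AA qq = phi 1 (qq (N := N)) := by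
  conv_lhs => rw [← phi_ee_q 1]
  rw [AA_ne (by simp), phi_ee_q]

theorem sig_q {N : ℕ} (π : Equiv.Perm (Fin (N+3))) : sig π qq = qq := by
  conv_lhs => rw [← phi_ee_q 1]
  rw [sig_phi, phi_ee_q]

theorem sig_Phi {N : ℕ} (π : Equiv.Perm (Fin (N+3))) (u : List (Fin (N+3))) :
    ∃ v : List (Fin (N+3)), v.length = u.length ∧ sig π (Phi u qq) = Phi v qq := by
  cases u with
  | nil => exact ⟨[], rfl, sig_q π⟩
  | cons i u => exact ⟨π i :: u, rfl, sig_phi _ _ _⟩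

theorem L1_one {N : ℕ} : L1 (1 : HX N) := by
  have := (L1_AA (N := N)).mul L1_AA.inv
  rwa [mul_inv_cancel] at this
theorem L2_one {N : ℕ} : L2 (1 : HX N) := by
  have := (L2_AA (N := N)).mul L2_AA.inv
  rwa [mul_inv_cancel] at this

theorem T2 {N : ℕ} (u : List (Fin (N+3))) (hu : ∀ i ∈ u, i = 0 ∨ i = 1) :
    ∃ γ : HX N, L2 γ ∧ γ (Phi u qq) = qq := by
  induction u with
  | nil => exact ⟨1, L2_one, rfl⟩
  | cons i u ih =>
    obtain ⟨γ, hγ, h⟩ := ih fun j hj => hu j (by simp [hj])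
    rcases hu i (by simp) with rfl | rfl
    · refine ⟨AA * liftH 0 γ hγ.1, L2_AA.mul hγ.lift_zero, ?_⟩
      change AA (liftH 0 γ hγ.1 (phi 0 (Phi u qq))) = _
      rw [lift_same, h, AA_0q]
    · refine ⟨AA⁻¹ * liftH 1 γ hγ.1, L2_AA.inv.mul hγ.lift_one, ?_⟩
      change AA⁻¹ (liftH 1 γ hγ.1 (phi 1 (Phi u qq))) = _
      rw [lift_same, h]
      exact hinv_eq _ AA_q

theorem T1 {N : ℕ} (m : ℕ) : ∀ u : List (Fin (N+3)), u.length ≤ m →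
    ∃ γ : HX N, L1 γ ∧ γ (Phi u qq) = qq := by
  induction m with
  | zero =>
    intro u hu
    have : u = [] := by simpa using hu
    subst this
    exact ⟨1, L1_one, rfl⟩
  | succ m ih =>
    have step : ∀ (i : Fin (N+3)) (u : List (Fin (N+3))), i ≠ 0 → u.length ≤ m →
        ∃ γ : HX N, L1 γ ∧ γ (phi i (Phi u qq)) = qq := by
      intro i u hi hu
      obtain ⟨γ, hγ, h⟩ := ih u hu
      refine ⟨AA⁻¹ * (sig (Equiv.swap 1 i) * liftH i γ hγ.1), L1_AA.inv.mul ((L1_sig ?_).mul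
        (hγ.lift hi)), ?_⟩
      · exact Equiv.swap_apply_of_ne_of_ne (by simp) hi.symm
      · rw [hmul, hmul, lift_same, h, sig_phi, Equiv.swap_apply_right]
        exact hinv_eq _ AA_q
    intro u hu
    match u with
    | [] => exact ⟨1, L1_one, rfl⟩
    | [i] =>
      by_cases hi : i = 0
      · subst hi
        exact ⟨AA, L1_AA, AA_0q⟩
      · exact step i [] hi (by simp)
    | i :: j :: u =>
      simp only [List.length_cons] at hu
      by_cases hi : i = 0
      · subst hi
        have comp : ∀ y, AA (Phi (0 :: j :: u) qq) = y → (∃ γ : HX N, L1 γ ∧ γ y = qq) →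
            ∃ γ : HX N, L1 γ ∧ γ (Phi (0 :: j :: u) qq) = qq := by
          rintro y hy ⟨γ, hγ, h⟩
          exact ⟨γ * AA, hγ.mul L1_AA, by rw [hmul, hy, h]⟩
        by_cases hj : j = 0
        · subst hj
          obtain ⟨v, hv, hv2⟩ := sig_Phi sw u
          refine comp _ (AA_00 _) ?_
          rw [hv2]
          exact step 1 (0 :: v) (by simp) (by simp [hv]; omega)
        · by_cases hj1 : j = 1
          · subst hj1
            exact comp _ (AA_01 _) (ih (0 :: u) (by simp; omega))
          · exact comp _ (AA_0j hj hj1 _) (ih (j :: u) (by simp; omega))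
      · exact step i (j :: u) hi (by simp; omega)

theorem T0 {N : ℕ} (u : List (Fin (N+3))) : ∃ g ∈ GG N, g (Phi u qq) = qq := by
  cases u with
  | nil => exact ⟨1, one_mem _, rfl⟩
  | cons i u =>
    obtain ⟨γ, ⟨a, h, hh, hh2⟩, h3⟩ := T1 u.length u le_rfl
    refine ⟨AA⁻¹ * (h * sig (Equiv.swap i 1)), mul_mem (inv_mem AA_mem) (mul_mem hh (sig_mem _)), ?_⟩
    rw [hmul, hmul]
    change AA⁻¹ (h (sig _ (phi i (Phi u qq)))) = _
    rw [sig_phi, Equiv.swap_apply_left]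
    refine hinv_eq _ ?_
    have := hh2.1 (Phi u qq)
    rw [h3] at this
    rw [AA_q]
    exact this.symm

theorem ptOrder_homeo {X : Type} [TopologicalSpace X] (h : X ≃ₜ X) (p : X) :
    ptOrder X (h p) = ptOrder X p := by
  have : setComponents X {h p}ᶜ = (fun S => h '' S) '' setComponents X {p}ᶜ := by
    ext C
    constructor
    · rintro ⟨x, hx, rfl⟩
      have hx' : h.symm x ∈ ({p}ᶜ : Set X) := by
        intro hh
        exact hx (by rw [← (show h.symm x = p from hh)]; simp)
      refine ⟨_, ⟨h.symm x, hx', rfl⟩, ?_⟩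
      dsimp only
      rw [h.image_connectedComponentIn hx', h.apply_symm_apply, image_compl_eq h.bijective,
        image_singleton]
    · rintro ⟨_, ⟨x, hx, rfl⟩, rfl⟩
      refine ⟨h x, fun hh => hx (h.injective hh), ?_⟩
      dsimp only
      rw [h.image_connectedComponentIn hx, image_compl_eq h.bijective, image_singleton]
  rw [ptOrder, this, ncard_image_of_injective _ h.injective.image_injective]
  rfl

theorem comp_q {N : ℕ} {i : Fin (N+3)} {x : WX N} (hx : x ≠ ee) :
    connectedComponentIn {qq}ᶜ (phi i x) = phi i '' {ee}ᶜ := by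
  have hm : phi i x ∈ ({qq}ᶜ : Set (WX N)) := fun h => hx (phi_eq_q.1 h)
  apply Subset.antisymm
  · obtain ⟨j, hj⟩ := avoid_q (A := connectedComponentIn {qq}ᶜ (phi i x))
      isPreconnected_connectedComponentIn
      fun h => (connectedComponentIn_subset _ _ h) rfl
    obtain ⟨y, hy⟩ := hj (mem_connectedComponentIn hm)
    have hji : j = i := by
      by_contra hne
      exact hx (phi_ne hy hne).2
    subst hji
    intro z hz
    obtain ⟨t, rfl⟩ := hj hz
    refine ⟨t, ?_, rfl⟩
    rintro rfl
    exact connectedComponentIn_subset _ _ hz (phi_ee_q _)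
  · refine (conn_branch i).subset_connectedComponentIn ⟨x, hx, rfl⟩ ?_
    rintro _ ⟨y, hy, rfl⟩ h
    exact hy (phi_eq_q.1 h)

theorem ptOrder_q {N : ℕ} : ptOrder (WX N) qq = N + 3 := by
  have : setComponents (WX N) {qq}ᶜ = range (fun i : Fin (N+3) => phi i '' {ee}ᶜ) := by
    ext C
    constructor
    · rintro ⟨x, hx, rfl⟩
      obtain ⟨i, y, rfl⟩ := phi_surj x
      exact ⟨i, (comp_q fun h => hx (phi_eq_q.2 h)).symm⟩
    · rintro ⟨i, rfl⟩
      exact ⟨phi i e1, fun h => ee_ne_e1 (phi_eq_q.1 h).symm, (comp_q ee_ne_e1.symm).symm⟩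
  have inj : Function.Injective (fun i : Fin (N+3) => phi i '' ({ee}ᶜ : Set (WX N))) := by
    intro i j hij
    have h1 : phi i e1 ∈ phi i '' ({ee}ᶜ : Set (WX N)) := ⟨e1, ee_ne_e1.symm, rfl⟩
    dsimp only at hij
    rw [hij] at h1
    obtain ⟨y, hy, h⟩ := h1
    by_contra hne
    exact ee_ne_e1 (phi_ne h (Ne.symm hne)).2.symm
  rw [ptOrder, this, ← image_univ, ncard_image_of_injective _ inj, ncard_univ]
  simp

theorem ptOrder_Br {N : ℕ} {x : WX N} (hx : x ∈ Br) : ptOrder (WX N) x = N + 3 := by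
  obtain ⟨u, rfl⟩ := hx
  obtain ⟨g, -, hg⟩ := T0 u
  have h := ptOrder_homeo g (Phi u qq)
  rw [hg, ptOrder_q] at h
  exact h.symm

theorem cell_compl {N : ℕ} (w : List (Fin (N+3))) : ∃ A B : Set (WX N),
    IsPreconnected A ∧ IsPreconnected B ∧ (∀ y, y ∉ range (Phi w) → y ∈ A ∨ y ∈ B) ∧
    (∀ y, y ∈ A ∨ y ∈ B → y ∈ range (Phi w) → y ∈ Br) ∧
    (ee ∈ range (Phi w) ∨ e1 ∈ range (Phi w) → B = ∅) ∧
    (ee ∈ range (Phi w) → e1 ∈ range (Phi w) → A = ∅) := by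
  induction w with
  | nil =>
    refine ⟨∅, ∅, isPreconnected_empty, isPreconnected_empty, ?_, ?_, ?_, ?_⟩
    · exact fun y hy => absurd ⟨y, rfl⟩ hy
    · rintro y (h | h) <;> exact absurd h (notMem_empty _)
    · exact fun _ => rfl
    · exact fun _ _ => rfl
  | cons i w ih =>
    have r1 : ∀ x, phi i x ∈ range (Phi (i :: w)) ↔ x ∈ range (Phi w) := by
      intro x
      constructor
      · rintro ⟨t, ht⟩
        exact ⟨t, phi_inj i ht⟩
      · rintro ⟨t, rfl⟩
        exact ⟨t, rfl⟩
    have ree : ee ∈ range (Phi (i :: w)) → i = 0 ∧ e1 ∈ range (Phi w) := by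
      rintro ⟨t, ht⟩
      obtain ⟨a, b⟩ := phi_eq_ee.1 ht
      exact ⟨a, t, b⟩
    have re1 : e1 ∈ range (Phi (i :: w)) → i = 1 ∧ e1 ∈ range (Phi w) := by
      rintro ⟨t, ht⟩
      obtain ⟨a, b⟩ := phi_eq_e1.1 ht
      exact ⟨a, t, b⟩
    have rC : ∀ y ∈ CC i, y ∈ range (Phi (i :: w)) → y ∈ Br := by
      rintro y hy ⟨t, rfl⟩
      have : Phi w t = ee := CC_inter hy
      change phi i (Phi w t) ∈ Br
      rw [this, phi_ee_q]
      exact qq_mem_Br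
    obtain ⟨A, B, hA, hB, h1, h2, h3, h4⟩ := ih
    have rD : ∀ x, x ∈ A ∨ x ∈ B → phi i x ∈ range (Phi (i :: w)) → phi i x ∈ Br := by
      intro x hx hr
      exact phi_mem_Br (h2 x hx ((r1 x).1 hr))
    have cA : IsPreconnected (phi i '' A) := hA.image _ (continuous_phi i).continuousOn
    have cB : IsPreconnected (phi i '' B) := hB.image _ (continuous_phi i).continuousOn
    by_cases he : ee ∈ range (Phi w)
    · have hB0 := h3 (Or.inl he)
      refine ⟨CC i, phi i '' A, conn_CC i, cA, ?_, ?_, ?_, ?_⟩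
      · intro y hy
        rcases CC_union i y with ⟨x, rfl⟩ | h
        · rcases h1 x (fun h => hy ((r1 x).2 h)) with h | h
          · exact Or.inr ⟨x, h, rfl⟩
          · rw [hB0] at h; exact absurd h (notMem_empty _)
        · exact Or.inl h
      · rintro y (h | ⟨x, h, rfl⟩)
        · exact rC y h
        · exact rD x (Or.inl h)
      · intro h
        rw [h4 he (h.elim (fun h => (ree h).2) (fun h => (re1 h).2)), image_empty]
      · intro a b
        have := (ree a).1.symm.trans (re1 b).1
        simp at this
    · have fin : ∀ A B : Set (WX N), IsPreconnected (phi i '' A) → IsPreconnected (phi i '' B) →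
          (∀ y, y ∉ range (Phi w) → y ∈ A ∨ y ∈ B) →
          (∀ x, x ∈ A ∨ x ∈ B → phi i x ∈ range (Phi (i :: w)) → phi i x ∈ Br) → ee ∈ A →
          (e1 ∈ range (Phi w) → B = ∅) → ∃ A B : Set (WX N),
          IsPreconnected A ∧ IsPreconnected B ∧
          (∀ y, y ∉ range (Phi (i :: w)) → y ∈ A ∨ y ∈ B) ∧
          (∀ y, y ∈ A ∨ y ∈ B → y ∈ range (Phi (i :: w)) → y ∈ Br) ∧
          (ee ∈ range (Phi (i :: w)) ∨ e1 ∈ range (Phi (i :: w)) → B = ∅) ∧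
          (ee ∈ range (Phi (i :: w)) → e1 ∈ range (Phi (i :: w)) → A = ∅) := by
        intro A B cA cB h1 rD heA h3
        refine ⟨CC i ∪ phi i '' A, phi i '' B, ?_, cB, ?_, ?_, ?_, ?_⟩
        · exact (conn_CC i).union qq (qq_mem_CC i) ⟨ee, heA, phi_ee_q i⟩ cA
        · intro y hy
          rcases CC_union i y with ⟨x, rfl⟩ | h
          · rcases h1 x (fun h => hy ((r1 x).2 h)) with h | h
            · exact Or.inl (Or.inr ⟨x, h, rfl⟩)
            · exact Or.inr ⟨x, h, rfl⟩
          · exact Or.inl (Or.inl h)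
        · rintro y ((h | ⟨x, h, rfl⟩) | ⟨x, h, rfl⟩)
          · exact rC y h
          · exact rD x (Or.inl h)
          · exact rD x (Or.inr h)
        · intro h
          rw [h3 (h.elim (fun h => (ree h).2) (fun h => (re1 h).2)), image_empty]
        · intro a b
          have := (ree a).1.symm.trans (re1 b).1
          simp at this
      rcases h1 ee he with h | h
      · exact fin A B cA cB h1 rD h fun h => h3 (Or.inr h)
      · refine fin B A cB cA (fun y hy => (h1 y hy).symm) (fun x hx => rD x hx.symm) h fun h' => ?_
        rw [h3 (Or.inr h')] at h
        exact absurd h (notMem_empty _)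

theorem ptOrder_not_Br {N : ℕ} {x : WX N} (hx : x ∉ Br) :
    ptOrder (WX N) x = 1 ∨ ptOrder (WX N) x = 2 := by
  have hne : (setComponents (WX N) {x}ᶜ).Nonempty := by
    by_cases h : x = qq
    · subst h; exact absurd qq_mem_Br hx
    · exact ⟨_, qq, Ne.symm h, rfl⟩
  have hle : (setComponents (WX N) {x}ᶜ).encard ≤ 2 := by
    by_contra hlt
    rw [not_le] at hlt
    have h3 : (3 : ℕ∞) ≤ (setComponents (WX N) {x}ᶜ).encard := by
      have := Order.add_one_le_of_lt hlt
      rwa [show (2 : ℕ∞) + 1 = 3 by norm_num] at this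
    obtain ⟨t, hts, ht⟩ := exists_subset_encard_eq h3
    obtain ⟨C1, C2, C3, h12, h13, h23, rfl⟩ := encard_eq_three.1 ht
    obtain ⟨y1, hy1, rfl⟩ := hts (show C1 ∈ _ by simp)
    obtain ⟨y2, hy2, rfl⟩ := hts (show C2 ∈ _ by simp)
    obtain ⟨y3, hy3, rfl⟩ := hts (show C3 ∈ _ by simp)
    have hU : ({y1, y2, y3}ᶜ : Set (WX N)) ∈ 𝓝 x := by
      refine (Set.toFinite _).isClosed.isOpen_compl.mem_nhds ?_
      rintro (h | h | h)
      · exact hy1 h.symm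
      · exact hy2 h.symm
      · exact hy3 h.symm
    obtain ⟨m, hm⟩ := small_cells hU
    obtain ⟨w, hw, t, ht⟩ := Phi_surj m x
    have hxw : x ∈ range (Phi w) := ⟨t, ht⟩
    have hs := hm w hw hxw
    obtain ⟨A, B, hA, hB, h1, h2, -, -⟩ := cell_compl w
    have hxA : A ⊆ {x}ᶜ := fun y hy h => by
      obtain rfl : y = x := h
      exact hx (h2 y (Or.inl hy) hxw)
    have hxB : B ⊆ {x}ᶜ := fun y hy h => by
      obtain rfl : y = x := h
      exact hx (h2 y (Or.inr hy) hxw)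
    have same : ∀ {T : Set (WX N)} {a b : WX N}, IsPreconnected T → T ⊆ {x}ᶜ → a ∈ T → b ∈ T →
        connectedComponentIn {x}ᶜ a = connectedComponentIn {x}ᶜ b := by
      intro T a b hT hTx ha hb
      exact connectedComponentIn_eq (hT.subset_connectedComponentIn ha hTx hb)
    have a1 := h1 y1 fun h => hs h (by simp)
    have a2 := h1 y2 fun h => hs h (by simp)
    have a3 := h1 y3 fun h => hs h (by simp)
    rcases a1 with a1 | a1 <;> rcases a2 with a2 | a2 <;> rcases a3 with a3 | a3
    · exact h12 (same hA hxA a1 a2)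
    · exact h12 (same hA hxA a1 a2)
    · exact h13 (same hA hxA a1 a3)
    · exact h23 (same hB hxB a2 a3)
    · exact h23 (same hA hxA a2 a3)
    · exact h13 (same hB hxB a1 a3)
    · exact h12 (same hB hxB a1 a2)
    · exact h12 (same hB hxB a1 a2)
  have hfin : (setComponents (WX N) {x}ᶜ).Finite := finite_of_encard_le_coe (k := 2) hle
  have h2 : ptOrder (WX N) x ≤ 2 := by
    rw [← hfin.cast_ncard_eq] at hle
    exact_mod_cast hle
  have h0 : 0 < ptOrder (WX N) x := (ncard_pos hfin).2 hne
  omega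

theorem homeo_Br {N : ℕ} (h : HX N) {x : WX N} (hx : x ∈ Br) : h x ∈ Br := by
  by_contra hc
  have h1 := ptOrder_not_Br hc
  have h2 := ptOrder_Br hx
  rw [ptOrder_homeo, h2] at h1
  omega

theorem isWaz {N : ℕ} : IsWazewskiDendrite (N+3) (WX N) := by
  refine ⟨⟨⟨ee⟩, inferInstance, inferInstance, inferInstance, inferInstance, no_circle⟩, ?_, ?_⟩
  · intro p
    by_cases h : p ∈ Br
    · exact Or.inr (Or.inr (ptOrder_Br h))
    · rcases ptOrder_not_Br h with h | h
      · exact Or.inl h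
      · exact Or.inr (Or.inl h)
  · rintro A ⟨f⟩
    have hc : IsPreconnected A := by
      have := f.symm.surjective.denseRange.preconnectedSpace f.symm.continuous
      exact isPreconnected_iff_preconnectedSpace.2 this
    by_contra hcon
    push Not at hcon
    have hs := avoid_Br hc (disjoint_left.2 fun x hx hb => hcon x hx (ptOrder_Br hb))
    have : f.symm 0 = f.symm 1 := Subtype.ext (hs (f.symm 0).2 (f.symm 1).2)
    have := f.symm.injective this
    simp at this

end Waz

namespace Waz

open Topology Set Uniformity

theorem bypass {N : ℕ} (u : List (Fin (N+3))) (hu : ¬ ∀ i ∈ u, i = 0 ∨ i = 1) :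
    ∃ S : Set (WX N), IsPreconnected S ∧ ee ∈ S ∧ e1 ∈ S ∧ Phi u qq ∉ S := by
  induction u with
  | nil => exact absurd (by simp) hu
  | cons i u ih =>
    have hP := Phi_q_ne u
    by_cases h0 : i = 0
    · subst h0
      obtain ⟨S, hS, he, he1, hn⟩ := ih fun h => hu (by simpa using h)
      refine ⟨phi 0 '' S ∪ range (phi 1), ?_, Or.inl ⟨e1, he1, phi_zero_e1⟩,
        Or.inr ⟨e1, phi_one_e1⟩, ?_⟩
      · exact (hS.image _ (continuous_phi 0).continuousOn).union qq ⟨ee, he, phi_ee_q 0⟩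
          ⟨ee, phi_ee_q 1⟩ (conn_phi 1)
      · rintro (⟨s, hs, h⟩ | ⟨s, h⟩)
        · rw [phi_inj 0 h] at hs
          exact hn hs
        · exact hP.1 (phi_ne h (by simp)).2
    · by_cases h1 : i = 1
      · subst h1
        obtain ⟨S, hS, he, he1, hn⟩ := ih fun h => hu (by simpa using h)
        refine ⟨phi 1 '' S ∪ range (phi 0), ?_, Or.inr ⟨e1, phi_zero_e1⟩,
          Or.inl ⟨e1, he1, phi_one_e1⟩, ?_⟩
        · exact (hS.image _ (continuous_phi 1).continuousOn).union qq ⟨ee, he, phi_ee_q 1⟩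
            ⟨ee, phi_ee_q 0⟩ (conn_phi 0)
        · rintro (⟨s, hs, h⟩ | ⟨s, h⟩)
          · rw [phi_inj 1 h] at hs
            exact hn hs
          · exact hP.1 (phi_ne h (by simp)).2
      · refine ⟨CC i, conn_CC i, mem_CC.2 ⟨0, Ne.symm h0, e1, phi_zero_e1⟩,
          mem_CC.2 ⟨1, Ne.symm h1, e1, phi_one_e1⟩, fun h => hP.1 (CC_inter h)⟩

theorem arc_letters {N : ℕ} {κ : HX N} (h0 : κ ee = ee) (h1 : κ e1 = e1)
    {u : List (Fin (N+3))} (hu : κ qq = Phi u qq) : ∀ i ∈ u, i = 0 ∨ i = 1 := by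
  by_contra hc
  obtain ⟨S, hS, he, he1, hn⟩ := bypass u hc
  have hS' : IsPreconnected ((κ⁻¹ : HX N) '' S) := hS.image _ (κ⁻¹ : HX N).continuous.continuousOn
  obtain ⟨i, hi⟩ := avoid_q hS' (by
    rintro ⟨s, hs, h⟩
    apply hn
    rw [← hu, ← h, hinv_r]
    exact hs)
  obtain ⟨x, hx⟩ := hi ⟨ee, he, inv_fix h0⟩
  obtain ⟨y, hy⟩ := hi ⟨e1, he1, inv_fix h1⟩
  have := (phi_eq_ee.1 hx).1.symm.trans (phi_eq_e1.1 hy).1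
  simp at this

theorem exists_letter {N : ℕ} {h : HX N} (hq : h qq = qq) (i : Fin (N+3)) :
    ∃ j, ∀ x, ∃ y, h (phi i x) = phi j y := by
  obtain ⟨j, hj⟩ := avoid_q ((conn_branch i).image h h.continuous.continuousOn) (by
    rintro ⟨_, ⟨x, hx, rfl⟩, h2⟩
    rw [← hq] at h2
    exact hx (phi_eq_q.1 (h.injective h2)))
  refine ⟨j, fun x => ?_⟩
  by_cases hx : x = ee
  · subst hx
    exact ⟨ee, by rw [phi_ee_q, phi_ee_q, hq]⟩
  · obtain ⟨y, hy⟩ := hj ⟨_, ⟨x, hx, rfl⟩, rfl⟩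
    exact ⟨y, hy.symm⟩

theorem decomp {N : ℕ} {h : HX N} (hq : h qq = qq) :
    ∃ (π : Equiv.Perm (Fin (N+3))) (κ : Fin (N+3) → HX N), (∀ i, κ i ee = ee) ∧
      ∀ i x, h (phi i x) = phi (π i) (κ i x) := by
  choose p hp using exists_letter hq
  choose p' hp' using exists_letter (h := h⁻¹) (hinv_eq h hq)
  have hpp : ∀ i, p' (p i) = i := by
    intro i
    obtain ⟨y, hy⟩ := hp i e1
    obtain ⟨z, hz⟩ := hp' (p i) y
    rw [← hy, hinv_l] at hz
    by_contra hne
    exact ee_ne_e1 (phi_ne hz (Ne.symm hne)).1.symm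
  have pinj : Function.Injective p := Function.LeftInverse.injective hpp
  have pbij : Function.Bijective p := Finite.injective_iff_bijective.1 pinj
  choose k hk using hp
  have kc : ∀ i, Continuous (k i) := by
    intro i
    rw [(closedEmbedding_phi (p i)).isInducing.continuous_iff]
    have : phi (p i) ∘ k i = h ∘ phi i := funext fun x => (hk i x).symm
    rw [this]
    exact h.continuous.comp (continuous_phi i)
  have kinj : ∀ i, Function.Injective (k i) := by
    intro i x y hxy
    have := hk i x
    rw [hxy, ← hk i y] at this
    exact phi_inj i (h.injective this)
  have ksurj : ∀ i, Function.Surjective (k i) := by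
    intro i y
    obtain ⟨z, hz⟩ := hp' (p i) y
    rw [hpp] at hz
    refine ⟨z, phi_inj (p i) ?_⟩
    rw [← hk, ← hz, hinv_r]
  refine ⟨Equiv.ofBijective p pbij, fun i => Continuous.homeoOfEquivCompactToT2
    (f := Equiv.ofBijective (k i) ⟨kinj i, ksurj i⟩) (kc i), fun i => ?_, fun i x => hk i x⟩
  have := hk i ee
  rw [phi_ee_q, hq] at this
  exact phi_eq_q.1 this.symm

/-- Cells of level `m` are preserved. -/
def Pres {N : ℕ} (m : ℕ) (f : HX N) : Prop :=
  ∀ w : List (Fin (N+3)), w.length = m → ∀ x, ∃ y, f (Phi w x) = Phi w y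

theorem pres_zero {N : ℕ} (f : HX N) : Pres 0 f := by
  intro w hw x
  have : w = [] := List.length_eq_zero_iff.1 hw
  subst this
  exact ⟨_, rfl⟩

theorem combine {N : ℕ} (m : ℕ) (Q : HX N → Prop) (h1 : Q 1) (hm : ∀ f g, Q f → Q g → Q (f * g))
    (f : HX N) (κ : Fin (N+3) → HX N) (hf : ∀ i x, f (phi i x) = phi i (κ i x))
    (hκ : ∀ i, ∃ (γ : HX N) (h : γ ee = ee), Q (liftH i γ h) ∧ Pres m (γ * κ i)) :
    ∃ γ, Q γ ∧ Pres (m+1) (γ * f) := by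
  choose γ hγ hQ hP using hκ
  have key : ∀ s : Finset (Fin (N+3)), ∃ g, Q g ∧
      ∀ i x, g (phi i x) = phi i (if i ∈ s then γ i x else x) := by
    intro s
    induction s using Finset.induction_on with
    | empty => exact ⟨1, h1, fun i x => by simp⟩
    | insert a s ha ih =>
      obtain ⟨g, hg, hg2⟩ := ih
      refine ⟨liftH a (γ a) (hγ a) * g, hm _ _ (hQ a) hg, fun i x => ?_⟩
      rw [hmul, hg2]
      by_cases hi : i = a
      · subst hi
        rw [lift_same, if_neg ha, if_pos (Finset.mem_insert_self _ _)]
      · rw [lift_ne _ _ _ hi]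
        simp [hi]
  obtain ⟨g, hg, hg2⟩ := key Finset.univ
  refine ⟨g, hg, ?_⟩
  intro w hw x
  cases w with
  | nil => simp at hw
  | cons i w =>
    obtain ⟨y, hy⟩ := hP i w (by simpa using hw) x
    refine ⟨y, ?_⟩
    change g (f (phi i (Phi w x))) = phi i (Phi w y)
    rw [hf, hg2, if_pos (Finset.mem_univ _), ← hy]
    rfl

theorem P12 {N : ℕ} (m : ℕ) :
    (∀ κ : HX N, κ ee = ee → ∃ γ, L1 γ ∧ Pres m (γ * κ)) ∧
    (∀ κ : HX N, κ ee = ee → κ e1 = e1 → ∃ γ, L2 γ ∧ Pres m (γ * κ)) := by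
  induction m with
  | zero => exact ⟨fun κ _ => ⟨1, L1_one, pres_zero _⟩, fun κ _ _ => ⟨1, L2_one, pres_zero _⟩⟩
  | succ m ih =>
    obtain ⟨ih1, ih2⟩ := ih
    constructor
    · intro κ h0
      obtain ⟨u, hu⟩ := homeo_Br κ qq_mem_Br
      obtain ⟨γ, hγ, hγu⟩ := T1 u.length u le_rfl
      have hq : (γ * κ : HX N) qq = qq := by rw [hmul, hu, hγu]
      have he : (γ * κ : HX N) ee = ee := by rw [hmul, h0, hγ.1]
      obtain ⟨π, k, hk, hpk⟩ := decomp hq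
      have h2 : phi (π 0) (k 0 e1) = ee := by rw [← hpk, phi_zero_e1, he]
      obtain ⟨p0, k0⟩ := phi_eq_ee.1 h2
      have p0' : π⁻¹ 0 = 0 := by rw [Equiv.Perm.inv_eq_iff_eq, p0]
      obtain ⟨g, hg, hg2⟩ := combine m L1 L1_one (fun _ _ a b => a.mul b)
        (sig π⁻¹ * (γ * κ)) k (fun i x => by
          rw [hmul, hpk, sig_phi]; simp) (fun i => by
          by_cases hi : i = 0
          · subst hi
            obtain ⟨g, hg, hg2⟩ := ih2 (k 0) (hk 0) k0
            exact ⟨g, hg.1, hg.lift_zero_L1, hg2⟩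
          · obtain ⟨g, hg, hg2⟩ := ih1 (k i) (hk i)
            exact ⟨g, hg.1, hg.lift hi, hg2⟩)
      refine ⟨g * (sig π⁻¹ * γ), hg.mul ((L1_sig p0').mul hγ), ?_⟩
      simpa only [mul_assoc] using hg2
    · intro κ h0 h1
      obtain ⟨u, hu⟩ := homeo_Br κ qq_mem_Br
      obtain ⟨γ, hγ, hγu⟩ := T2 u (arc_letters h0 h1 hu)
      have hq : (γ * κ : HX N) qq = qq := by rw [hmul, hu, hγu]
      have he : (γ * κ : HX N) ee = ee := by rw [hmul, h0, hγ.1]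
      have he1 : (γ * κ : HX N) e1 = e1 := by rw [hmul, h1, hγ.2.1]
      obtain ⟨π, k, hk, hpk⟩ := decomp hq
      have h2 : phi (π 0) (k 0 e1) = ee := by rw [← hpk, phi_zero_e1, he]
      have h3 : phi (π 1) (k 1 e1) = e1 := by rw [← hpk, phi_one_e1, he1]
      obtain ⟨p0, k0⟩ := phi_eq_ee.1 h2
      obtain ⟨p1, k1⟩ := phi_eq_e1.1 h3
      have p0' : π⁻¹ 0 = 0 := by rw [Equiv.Perm.inv_eq_iff_eq, p0]
      have p1' : π⁻¹ 1 = 1 := by rw [Equiv.Perm.inv_eq_iff_eq, p1]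
      obtain ⟨g, hg, hg2⟩ := combine m L2 L2_one (fun _ _ a b => a.mul b)
        (sig π⁻¹ * (γ * κ)) k (fun i x => by
          rw [hmul, hpk, sig_phi]; simp) (fun i => by
          by_cases hi : i = 0
          · subst hi
            obtain ⟨g, hg, hg2⟩ := ih2 (k 0) (hk 0) k0
            exact ⟨g, hg.1, hg.lift_zero, hg2⟩
          · by_cases hi1 : i = 1
            · subst hi1
              obtain ⟨g, hg, hg2⟩ := ih2 (k 1) (hk 1) k1
              exact ⟨g, hg.1, hg.lift_one, hg2⟩
            · obtain ⟨g, hg, hg2⟩ := ih1 (k i) (hk i)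
              exact ⟨g, hg.1, hg.lift_L2 hi hi1, hg2⟩)
      refine ⟨g * (sig π⁻¹ * γ), hg.mul ((L2_sig p0' p1').mul hγ), ?_⟩
      simpa only [mul_assoc] using hg2

theorem act_unique {N : ℕ} {w : List (Fin (N+3))} {f h h' : HX N} (a : Act w f h)
    (b : Act w f h') : h = h' := by
  refine Homeomorph.ext fun x => ?_
  by_cases hx : x ∈ range (Phi w)
  · obtain ⟨y, rfl⟩ := hx
    rw [a.1, b.1]
  · rw [a.2 x hx, b.2 x hx]

theorem L1.lift_mem {N : ℕ} {f : HX N} (hf : L1 f) (i : Fin (N+3)) : liftH i f hf.1 ∈ GG N := by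
  obtain ⟨a, h, hh, ha⟩ := hf
  have hc := ha.conj (w' := [i]) (sig (Equiv.swap i 1)) (fun x => by
    change sig _ (phi i x) = phi 1 x
    rw [sig_phi, Equiv.swap_apply_left])
  rw [act_unique (act_lift i f a) hc]
  exact mul_mem (mul_mem (inv_mem (sig_mem _)) hh) (sig_mem _)

theorem P0 {N : ℕ} (m : ℕ) (h : HX N) : ∃ g ∈ GG N, Pres m (g * h) := by
  cases m with
  | zero => exact ⟨1, one_mem _, pres_zero _⟩
  | succ m =>
    obtain ⟨u, hu⟩ := homeo_Br h qq_mem_Br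
    obtain ⟨γ, hγ, hγu⟩ := T0 u
    have hq : (γ * h : HX N) qq = qq := by rw [hmul, hu, hγu]
    obtain ⟨π, k, hk, hpk⟩ := decomp hq
    obtain ⟨g, hg, hg2⟩ := combine m (fun f => f ∈ GG N) (one_mem _) (fun _ _ a b => mul_mem a b)
        (sig π⁻¹ * (γ * h)) k (fun i x => by
          rw [hmul, hpk, sig_phi]; simp) (fun i => by
          obtain ⟨g, hg, hg2⟩ := (P12 m).1 (k i) (hk i)
          exact ⟨g, hg.1, hg.lift_mem i, hg2⟩)
    refine ⟨g * (sig π⁻¹ * γ), mul_mem hg (mul_mem (sig_mem _) hγ), ?_⟩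
    simpa only [mul_assoc] using hg2

theorem dense_GG {N : ℕ} : Dense (GG N : Set (HX N)) := by
  intro h
  have hP : ∀ m, ∃ g ∈ GG N, Pres m (g * h⁻¹) := fun m => P0 m h⁻¹
  choose g hg hP using hP
  refine closure_induced.2 ?_
  refine mem_closure_of_tendsto (f := fun m : ℕ => ((g m : HX N) : C(WX N, WX N)))
    (b := Filter.atTop) ?_ (Filter.Eventually.of_forall fun m => ⟨g m, hg m, rfl⟩)
  rw [ContinuousMap.tendsto_iff_tendstoUniformly]
  intro V hV
  obtain ⟨m0, hm0⟩ := shrink hV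
  filter_upwards [Filter.eventually_ge_atTop m0] with m hm
  intro x
  obtain ⟨w, hw, z, hz⟩ := Phi_surj m (h x)
  obtain ⟨y, hy⟩ := hP m w hw z
  rw [hz, hmul, hinv_l] at hy
  change (h x, g m x) ∈ V
  rw [← hz, hy, ← List.take_append_drop m0 w, Phi_append, Phi_append]
  exact hm0 _ (by rw [List.length_take, hw]; omega) _ _

theorem main (N : ℕ) : ∃ (G K H : Subgroup (HX N)),
      Dense (G : Set (HX N)) ∧
      Nonempty (K ≃* Equiv.Perm (Fin (N+3))) ∧
      (∃ a b : HX N, H = Subgroup.closure {a, b}) ∧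
      G = Subgroup.closure ((K : Set (HX N)) ∪ (H : Set (HX N))) ∧
      ∃ S : Finset (HX N), S.card ≤ N + 3 + 1 ∧ Subgroup.closure (S : Set (HX N)) = G := by
  classical
  refine ⟨GG N, (sig (N := N)).range, Subgroup.closure {tau, bb}, dense_GG,
    ⟨(MonoidHom.ofInjective sig_injective).symm⟩, ⟨tau, bb, rfl⟩, ?_, ?_⟩
  · rw [GG, Subgroup.closure_union, Subgroup.closure_union, Subgroup.closure_eq (Subgroup.closure _),
      MonoidHom.coe_range]
  · refine ⟨Finset.univ.image (fun i : Fin (N+2) => sig (Equiv.swap i.castSucc i.succ)) ∪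
      {tau, bb}, ?_, ?_⟩
    · refine (Finset.card_union_le _ _).trans ?_
      have h1 : (Finset.univ.image
        (fun i : Fin (N+2) => sig (N := N) (Equiv.swap i.castSucc i.succ))).card ≤ N + 2 :=
        Finset.card_image_le.trans (by simp)
      have h2 : ({tau, bb} : Finset (HX N)).card ≤ 2 := Finset.card_le_two
      omega
    · have hc : Subgroup.closure (range fun i : Fin (N+2) => Equiv.swap i.castSucc i.succ) = ⊤ := by
        refine top_le_iff.1 fun x _ => ?_
        have := Equiv.Perm.mclosure_swap_castSucc_succ (N+2)
        have hx : x ∈ Submonoid.closure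
          (range fun i : Fin (N+2) => Equiv.swap i.castSucc i.succ) := by
          rw [this]; trivial
        exact Subgroup.le_closure_toSubmonoid _ hx
      rw [Finset.coe_union, Finset.coe_image, Finset.coe_univ, image_univ, GG,
        Subgroup.closure_union, Subgroup.closure_union]
      congr 1
      · have : (range fun i : Fin (N+2) => sig (N := N) (Equiv.swap i.castSucc i.succ)) =
            sig '' (range fun i : Fin (N+2) => Equiv.swap i.castSucc i.succ) := by
          rw [← range_comp]; rfl
        rw [this, ← MonoidHom.map_closure, hc, ← MonoidHom.range_eq_map, ← MonoidHom.coe_range,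
          Subgroup.closure_eq]
      · simp

end Waz

theorem statement1 (n : ℕ) (hn : 3 ≤ n) :
    ∃ (X : Type) (_ : TopologicalSpace X) (_ : IsWazewskiDendrite n X)
      (G K H : Subgroup (X ≃ₜ X)),
      Dense (G : Set (X ≃ₜ X)) ∧
      Nonempty (K ≃* Equiv.Perm (Fin n)) ∧
      (∃ a b : X ≃ₜ X, H = Subgroup.closure {a, b}) ∧
      G = Subgroup.closure ((K : Set (X ≃ₜ X)) ∪ (H : Set (X ≃ₜ X))) ∧
      ∃ S : Finset (X ≃ₜ X), S.card ≤ n + 1 ∧ Subgroup.closure (S : Set (X ≃ₜ X)) = G := by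
  obtain ⟨N, rfl⟩ : ∃ N, n = N + 3 := ⟨n - 3, by omega⟩
  exact ⟨Waz.WX N, inferInstance, Waz.isWaz, Waz.main N⟩
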